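/- Let G be a minor-minimal enemy. Then there exists no non-trivial 4-separation (A,B) of G such that G[A] and G[B] both have an (A ∩ B)-rooted K4-model. -/

import Mathlib

open SimpleGraph

/-- `K7vee` is the graph obtained from `K 7` by deleting two edges with a common end. -/
def K7vee : SimpleGraph (Fin 7) :=
  (completeGraph (Fin 7)).deleteEdges {s(0, 1), s(0, 2)}

/-- `K6vee` is the graph obtained from `K 6` by deleting two edges with a common end. -/
def K6vee : SimpleGraph (Fin 6) :=
  (completeGraph (Fin 6)).deleteEdges {s(0, 1), s(0, 2)}

/-- The complete multipartite graph with four parts of size two. -/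
def K2222 : SimpleGraph (Fin 4 × Fin 2) :=
  SimpleGraph.comap Prod.fst (completeGraph (Fin 4))

/-- `H` is a minor of `G`: there is a model of `H` in `G`, i.e. a family of pairwise disjoint
nonempty connected branch sets, one for each vertex of `H`, with edges of `G` between branch
sets corresponding to adjacent vertices of `H`. -/
def IsMinor {W V : Type} (H : SimpleGraph W) (G : SimpleGraph V) : Prop :=
  ∃ bag : W → Set V,
    (∀ w, (G.induce (bag w)).Connected) ∧
    (∀ w w', w ≠ w' → Disjoint (bag w) (bag w')) ∧
    (∀ w w', H.Adj w w' → ∃ u ∈ bag w, ∃ v ∈ bag w', G.Adj u v)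

/-- A graph is `k`-connected if it has more than `k` vertices and stays connected after
removing any set of fewer than `k` vertices. -/
def IsKConnected {V : Type} [Fintype V] (k : ℕ) (G : SimpleGraph V) : Prop :=
  k < Fintype.card V ∧ ∀ S : Set V, S.ncard < k → (G.induce (Sᶜ : Set V)).Connected

/-- A separation of `G`: `A ∪ B = V(G)` and no edge joins `A - B` to `B - A`. -/
def IsSeparation {V : Type} (G : SimpleGraph V) (A B : Set V) : Prop :=
  A ∪ B = Set.univ ∧ ∀ ⦃u v : V⦄, G.Adj u v → ¬(u ∈ A \ B ∧ v ∈ B \ A)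

/-- `(G, Z)` is internally `k`-connected: every separation `(A,B)` of `G` with `Z ⊆ A`
and `B - A ≠ ∅` has order at least `k`. -/
def InternallyConnected {V : Type} (G : SimpleGraph V) (Z : Set V) (k : ℕ) : Prop :=
  ∀ A B : Set V, IsSeparation G A B → Z ⊆ A → (B \ A).Nonempty →
    k ≤ (A ∩ B).ncard

/-- A `Z`-rooted `K₄`-model in `G`. -/
def HasRootedK4Model {V : Type} (G : SimpleGraph V) (Z : Set V) : Prop :=
  ∃ B : Fin 4 → Set V,
    (∀ i, (G.induce (B i)).Connected) ∧
    (∀ i j, i ≠ j → Disjoint (B i) (B j)) ∧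
    (∀ i, ∃! z : V, z ∈ Z ∧ z ∈ B i) ∧
    (∀ z ∈ Z, ∃ i, z ∈ B i) ∧
    (∀ i j, i ≠ j → ∃ u ∈ B i, ∃ v ∈ B j, G.Adj u v)

/-- A `Z`-rooted `K*₄,₂`-model in `G`. -/
def HasRootedK42starModel {V : Type} (G : SimpleGraph V) (Z : Set V) : Prop :=
  ∃ (B : Fin 4 → Set V) (C : Fin 2 → Set V),
    (∀ i, (G.induce (B i)).Connected) ∧
    (∀ j, (G.induce (C j)).Connected) ∧
    (∀ i j, i ≠ j → Disjoint (B i) (B j)) ∧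
    (∀ i j, i ≠ j → Disjoint (C i) (C j)) ∧
    (∀ i j, Disjoint (B i) (C j)) ∧
    (∀ i, ∃! z : V, z ∈ Z ∧ z ∈ B i) ∧
    (∀ z ∈ Z, ∃ i, z ∈ B i) ∧
    (∀ i j, ∃ u ∈ B i, ∃ v ∈ C j, G.Adj u v) ∧
    (∃ u ∈ C 0, ∃ v ∈ C 1, G.Adj u v)

/-- An enemy: a `4`-connected graph with `|E(G)| ≥ 4|V(G)| - 8`, with no `K7vee`-minor,
not isomorphic to `K_{2,2,2,2}`. -/
def Enemy {V : Type} [Fintype V] (G : SimpleGraph V) : Prop :=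
  IsKConnected 4 G ∧
    4 * (Fintype.card V : ℤ) - 8 ≤ (G.edgeSet.ncard : ℤ) ∧
    ¬ IsMinor K7vee G ∧
    IsEmpty (G ≃g K2222)

/-- A minor-minimal enemy: an enemy, no minor of which, other than itself, is an enemy. -/
def MinorMinimalEnemy {V : Type} [Fintype V] (G : SimpleGraph V) : Prop :=
  Enemy G ∧ ∀ (W : Type) [Fintype W] (H : SimpleGraph W),
    IsMinor H G → Enemy H → Nonempty (H ≃g G)

/-- The simple graph obtained from `G` by contracting the edge `uv`
(`v` is merged into `u`). -/
def contractEdge {V : Type} (G : SimpleGraph V) (u v : V) :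
    SimpleGraph {x : V // x ≠ v} :=
  SimpleGraph.fromRel (fun x y => G.Adj ↑x ↑y ∨ ((x : V) = u ∧ G.Adj v ↑y))

/-- A graph is `7`-contraction-critical if its chromatic number is `7` and
every minor of it, other than itself, has chromatic number less than `7`. -/
def ContractionCritical7 {V : Type} [Fintype V] (G : SimpleGraph V) : Prop :=
  G.chromaticNumber = 7 ∧
    ∀ (W : Type) [Fintype W] (H : SimpleGraph W),
      IsMinor H G → IsEmpty (H ≃g G) → H.chromaticNumber < 7

section ConnectedSets

open scoped Classical

/-- Two sets of vertices are joined by an edge. -/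
def Touch {V : Type} (G : SimpleGraph V) (S T : Set V) : Prop :=
  ∃ u ∈ S, ∃ v ∈ T, G.Adj u v

/-- Any two vertices of `S` are joined by a walk inside `S`. -/
def PreconnOn {V : Type} (G : SimpleGraph V) (S : Set V) : Prop :=
  ∀ a ∈ S, ∀ b ∈ S, Relation.ReflTransGen (fun u v => G.Adj u v ∧ u ∈ S ∧ v ∈ S) a b

variable {V : Type} {G : SimpleGraph V}

theorem Touch.symm {S T : Set V} (h : Touch G S T) : Touch G T S := by
  obtain ⟨u, hu, v, hv, e⟩ := h
  exact ⟨v, hv, u, hu, e.symm⟩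

theorem Touch.mono {S T S' T' : Set V} (h : Touch G S T) (hS : S ⊆ S') (hT : T ⊆ T') :
    Touch G S' T' := by
  obtain ⟨u, hu, v, hv, e⟩ := h
  exact ⟨u, hS hu, v, hT hv, e⟩

theorem walkOn_mono {S T : Set V} (h : S ⊆ T) {a b : V}
    (hab : Relation.ReflTransGen (fun u v => G.Adj u v ∧ u ∈ S ∧ v ∈ S) a b) :
    Relation.ReflTransGen (fun u v => G.Adj u v ∧ u ∈ T ∧ v ∈ T) a b :=
  Relation.ReflTransGen.mono (fun _ _ ⟨e, hu, hv⟩ => ⟨e, h hu, h hv⟩) _ _ hab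

theorem walkOn_symm {S : Set V} {a b : V}
    (hab : Relation.ReflTransGen (fun u v => G.Adj u v ∧ u ∈ S ∧ v ∈ S) a b) :
    Relation.ReflTransGen (fun u v => G.Adj u v ∧ u ∈ S ∧ v ∈ S) b a := by
  induction hab with
  | refl => exact .refl
  | tail _ h ih => exact .head ⟨h.1.symm, h.2.2, h.2.1⟩ ih

theorem preconnOn_of_center {S : Set V} (c : V)
    (h : ∀ a ∈ S, Relation.ReflTransGen (fun u v => G.Adj u v ∧ u ∈ S ∧ v ∈ S) c a) :
    PreconnOn G S :=
  fun a ha b hb => (walkOn_symm (h a ha)).trans (h b hb)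

theorem preconnOn_singleton (a : V) : PreconnOn G {a} := by
  rintro x rfl y rfl
  exact .refl

theorem preconnOn_empty : PreconnOn G ∅ := fun _ h => h.elim

theorem PreconnOn.union {S T : Set V} (hS : PreconnOn G S) (hT : PreconnOn G T)
    (h : Touch G S T) : PreconnOn G (S ∪ T) := by
  obtain ⟨u, hu, v, hv, e⟩ := h
  refine preconnOn_of_center u ?_
  rintro a (ha | ha)
  · exact walkOn_mono Set.subset_union_left (hS u hu a ha)
  · exact .head ⟨e, .inl hu, .inr hv⟩ (walkOn_mono Set.subset_union_right (hT v hv a ha))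

theorem PreconnOn.union_of_mem {S T : Set V} (hS : PreconnOn G S) (hT : PreconnOn G T)
    {u : V} (hu : u ∈ S) (hv : u ∈ T) : PreconnOn G (S ∪ T) := by
  refine preconnOn_of_center u ?_
  rintro a (ha | ha)
  · exact walkOn_mono Set.subset_union_left (hS u hu a ha)
  · exact walkOn_mono Set.subset_union_right (hT u hv a ha)

theorem PreconnOn.mono_graph {G' : SimpleGraph V} {S : Set V} (hS : PreconnOn G S)
    (h : ∀ u ∈ S, ∀ v ∈ S, G.Adj u v → G'.Adj u v) : PreconnOn G' S :=
  fun a ha b hb => Relation.ReflTransGen.mono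
    (fun u v ⟨e, hu, hv⟩ => ⟨h u hu v hv e, hu, hv⟩) _ _ (hS a ha b hb)

theorem induce_connected_iff {S : Set V} :
    (G.induce S).Connected ↔ S.Nonempty ∧ PreconnOn G S := by
  constructor
  · intro h
    refine ⟨Set.nonempty_coe_sort.1 h.nonempty, fun a ha b hb => ?_⟩
    have := (SimpleGraph.reachable_iff_reflTransGen _ _).1 (h.preconnected ⟨a, ha⟩ ⟨b, hb⟩)
    exact Relation.ReflTransGen.lift (fun x : S => (x : V))
      (fun x y hxy => ⟨hxy, x.2, y.2⟩) _ _ this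
  · rintro ⟨hne, h⟩
    have := hne.to_subtype
    refine ⟨fun a b => ?_⟩
    rw [SimpleGraph.reachable_iff_reflTransGen]
    have key : ∀ y, Relation.ReflTransGen (fun u v => G.Adj u v ∧ u ∈ S ∧ v ∈ S) a.1 y →
        ∀ hy : y ∈ S, Relation.ReflTransGen (G.induce S).Adj a ⟨y, hy⟩ := by
      intro y hy
      induction hy with
      | refl => exact fun _ => .refl
      | tail _ e ih => exact fun hy => (ih e.2.1).tail e.1
    exact key b.1 (h a.1 a.2 b.1 b.2) b.2

/-- A family of disjoint connected sets realising the edges of `H` carries connected sets of `H`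
to connected sets of `G`. -/
theorem PreconnOn.biUnion {W : Type} {H : SimpleGraph W} {β : W → Set V}
    (hβ : ∀ a, PreconnOn G (β a)) (hadj : ∀ a b, H.Adj a b → Touch G (β a) (β b))
    {S : Set W} (hS : PreconnOn H S) : PreconnOn G (⋃ a ∈ S, β a) := by
  have key : ∀ a ∈ S, ∀ u ∈ β a, ∀ b,
      Relation.ReflTransGen (fun u v => H.Adj u v ∧ u ∈ S ∧ v ∈ S) a b → b ∈ S →
      ∀ v ∈ β b, Relation.ReflTransGen
        (fun x y => G.Adj x y ∧ x ∈ (⋃ a ∈ S, β a) ∧ y ∈ (⋃ a ∈ S, β a)) u v := by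
    intro a ha u hu b hab
    induction hab with
    | refl =>
      exact fun _ v hv => walkOn_mono (Set.subset_biUnion_of_mem (u := β) ha) (hβ a u hu v hv)
    | @tail b c _ e ih =>
      intro hc v hv
      obtain ⟨p, hp, q, hq, epq⟩ := hadj b c e.1
      refine (ih e.2.1 p hp).trans (.head ⟨epq, ?_, ?_⟩
        (walkOn_mono (Set.subset_biUnion_of_mem (u := β) hc) (hβ c q hq v hv)))
      · exact Set.mem_biUnion e.2.1 hp
      · exact Set.mem_biUnion hc hq
  intro u hu v hv
  simp only [Set.mem_iUnion] at hu hv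
  obtain ⟨a, ha, hu⟩ := hu
  obtain ⟨b, hb, hv⟩ := hv
  exact key a ha u hu b (hS a ha b hb) hb v hv

theorem Touch.biUnion {W : Type} {H : SimpleGraph W} {β : W → Set V}
    (hadj : ∀ a b, H.Adj a b → Touch G (β a) (β b)) {S T : Set W} (h : Touch H S T) :
    Touch G (⋃ a ∈ S, β a) (⋃ a ∈ T, β a) := by
  obtain ⟨a, ha, b, hb, e⟩ := h
  exact (hadj a b e).mono (Set.subset_biUnion_of_mem (u := β) ha)
    (Set.subset_biUnion_of_mem (u := β) hb)

theorem disjoint_biUnion_of_disjoint {W : Type} {β : W → Set V}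
    (hβ : ∀ a b, a ≠ b → Disjoint (β a) (β b)) {S T : Set W} (h : Disjoint S T) :
    Disjoint (⋃ a ∈ S, β a) (⋃ a ∈ T, β a) := by
  simp only [Set.disjoint_iUnion_left, Set.disjoint_iUnion_right]
  exact fun a ha b hb => hβ _ _ fun e => Set.disjoint_left.1 h (e ▸ hb) (by simpa using ha)

theorem IsMinor.trans {U W : Type} {F : SimpleGraph U} {H : SimpleGraph W} {G : SimpleGraph V}
    (hFH : IsMinor F H) (hHG : IsMinor H G) : IsMinor F G := by
  obtain ⟨γ, hγ, hγd, hγa⟩ := hFH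
  obtain ⟨β, hβ, hβd, hβa⟩ := hHG
  refine ⟨fun u => ⋃ a ∈ γ u, β a, fun u => ?_, fun u v huv => ?_, fun u v huv => ?_⟩
  · obtain ⟨⟨a, ha⟩, hpc⟩ := induce_connected_iff.1 (hγ u)
    obtain ⟨⟨b, hb⟩, -⟩ := induce_connected_iff.1 (hβ a)
    exact induce_connected_iff.2 ⟨⟨b, Set.mem_biUnion ha hb⟩,
      hpc.biUnion (fun a => (induce_connected_iff.1 (hβ a)).2) hβa⟩
  · exact disjoint_biUnion_of_disjoint hβd (hγd u v huv)
  · exact Touch.biUnion hβa (hγa u v huv)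

/-- A connected set meeting `T` contains a connected subset through a given vertex that meets
`T` exactly once. -/
theorem PreconnOn.exists_subset_meeting_once {S : Set V} (hS : PreconnOn G S) {z t : V}
    (hz : z ∈ S) (ht : t ∈ S) (T : Set V) (htT : t ∈ T) :
    ∃ Q ⊆ S, z ∈ Q ∧ PreconnOn G Q ∧ ∃ n, Q ∩ T = {n} := by
  have h := hS z hz t ht
  induction h using Relation.ReflTransGen.head_induction_on with
  | refl =>
    exact ⟨{t}, by simpa using ht, rfl, preconnOn_singleton t, t, by simpa using htT⟩
  | @head a c e _ ih =>
    by_cases haT : a ∈ T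
    · exact ⟨{a}, by simpa using hz, rfl, preconnOn_singleton a, a, by simpa using haT⟩
    obtain ⟨Q, hQS, hcQ, hQ, n, hn⟩ := ih e.2.2
    refine ⟨{a} ∪ Q, Set.union_subset (by simpa using hz) hQS, .inl rfl,
      (preconnOn_singleton a).union hQ ⟨a, rfl, c, hcQ, e.1⟩, n, ?_⟩
    rw [Set.union_inter_distrib_right, hn, Set.singleton_inter_eq_empty.2 haT, Set.empty_union]

/-- A walk starting in a set closed under adjacency stays there. -/
theorem PreconnOn.subset_of_closed {S : Set V} (hS : PreconnOn G S) {z : V} (hz : z ∈ S)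
    {X : Set V} (hzX : z ∈ X) (hX : ∀ u ∈ S, ∀ v ∈ S, G.Adj u v → u ∈ X → v ∈ X) : S ⊆ X := by
  intro t ht
  have h := hS z hz t ht
  induction h with
  | refl => exact hzX
  | tail _ e ih => exact hX _ e.2.1 _ e.2.2 e.1 (ih e.2.1)

end ConnectedSets

section DisjointConnections

open scoped Classical

variable {V : Type}

/-- The edges of `G` with both ends in `X`, as a graph on all vertices. -/
def keepIn (G : SimpleGraph V) (X : Finset V) : SimpleGraph V where
  Adj u v := G.Adj u v ∧ u ∈ X ∧ v ∈ X
  symm := ⟨fun _ _ h => ⟨h.1.symm, h.2.2, h.2.1⟩⟩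
  loopless := ⟨fun u h => G.loopless.irrefl u h.1⟩

theorem PreconnOn.subset_keepIn {G : SimpleGraph V} {X : Finset V} {S : Set V} {z : V}
    (hS : PreconnOn (keepIn G X) S) (hz : z ∈ S) (hzX : z ∈ X) : S ⊆ (X : Set V) :=
  hS.subset_of_closed hz hzX fun _ _ _ _ h _ => h.2.2

/-- Disjoint connections in `X` and in `Y` are spliced along `X ∩ Y` and the edge `x y`. -/
theorem exists_disjoint_splice {G : SimpleGraph V} {Z T X Y : Finset V} {x y : V}
    (hxY : x ∉ Y) (hyX : y ∉ X) (exy : G.Adj x y)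
    (hc : (insert x (X ∩ Y)).card ≤ Z.card) {P Q : V → Set V}
    (hP : ∀ z ∈ Z, z ∈ P z ∧ PreconnOn G (P z) ∧ ∃ t ∈ insert x (X ∩ Y), t ∈ P z)
    (hPd : ∀ z ∈ Z, ∀ w ∈ Z, z ≠ w → Disjoint (P z) (P w))
    (hsub1 : ∀ z ∈ Z, P z ⊆ (X : Set V))
    (hQ : ∀ z ∈ insert y (Y ∩ X), z ∈ Q z ∧ PreconnOn G (Q z) ∧ ∃ t ∈ T, t ∈ Q z)
    (hQd : ∀ z ∈ insert y (Y ∩ X), ∀ w ∈ insert y (Y ∩ X), z ≠ w → Disjoint (Q z) (Q w))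
    (hsub2 : ∀ s ∈ insert y (Y ∩ X), Q s ⊆ (Y : Set V)) :
    ∃ P : V → Set V, (∀ z ∈ Z, z ∈ P z ∧ PreconnOn G (P z) ∧ ∃ t ∈ T, t ∈ P z) ∧
      ∀ z ∈ Z, ∀ w ∈ Z, z ≠ w → Disjoint (P z) (P w) := by
  choose! f hfT hfP using fun z hz => (hP z hz).2.2
  have hinj : Set.InjOn f Z := fun z hz w hw hzw => by
    by_contra hne
    exact Set.disjoint_left.1 (hPd z hz w hw hne) (hfP z hz) (hzw ▸ hfP w hw)
  have hsurj : ∀ s ∈ insert x (X ∩ Y), ∃ z ∈ Z, f z = s := by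
    intro s hs
    have := Finset.surj_on_of_inj_on_of_card_le (fun z (_ : z ∈ Z) => f z) (fun z hz => hfT z hz)
      (fun z w hz hw e => hinj hz hw e) hc s hs
    obtain ⟨z, hz, e⟩ := this
    exact ⟨z, hz, e.symm⟩
  set σ : V → V := fun s => if s = x then y else s with hσ
  have hσmem : ∀ s ∈ insert x (X ∩ Y), σ s ∈ insert y (Y ∩ X) := by
    intro s hs
    by_cases h : s = x
    · simp [hσ, h]
    · simp only [hσ, h, if_false, Finset.mem_insert, Finset.mem_inter, false_or] at *
      tauto
  have hσinj : Set.InjOn σ (insert x (X ∩ Y) : Finset V) := by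
    intro s hs t ht hst
    have hs' := Finset.mem_insert.1 (Finset.mem_coe.1 hs)
    have ht' := Finset.mem_insert.1 (Finset.mem_coe.1 ht)
    rw [Finset.mem_inter] at hs' ht'
    by_cases h1 : s = x <;> by_cases h2 : t = x <;> simp only [hσ, h1, h2, if_true, if_false] at hst
    · rw [h1, h2]
    · exact (hyX (hst ▸ (ht'.resolve_left h2).1)).elim
    · exact (hyX (hst ▸ (hs'.resolve_left h1).1)).elim
    · exact hst
  have hcross : ∀ z ∈ Z, ∀ s ∈ insert y (Y ∩ X), ∀ v ∈ P z, v ∈ Q s → s = σ (f z) := by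
    intro z hz s hs v hvP hvQ
    have hvX : v ∈ X := hsub1 z hz hvP
    have hvY : v ∈ Y := hsub2 s hs hvQ
    obtain ⟨w, hw, rfl⟩ := hsurj v (by simp [hvX, hvY])
    have hwz : w = z := by
      by_contra hne
      exact Set.disjoint_left.1 (hPd w hw z hz hne) (hfP w hw) hvP
    subst hwz
    have hvx : f w ≠ x := fun h => hxY (h ▸ hvY)
    have hmem : f w ∈ insert y (Y ∩ X) := by simp [hvX, hvY]
    by_contra hne
    simp only [hσ, hvx, if_false] at hne
    exact Set.disjoint_left.1 (hQd s hs _ hmem hne) hvQ (hQ _ hmem).1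
  refine ⟨fun z => P z ∪ Q (σ (f z)), fun z hz => ⟨.inl (hP z hz).1, ?_, ?_⟩, ?_⟩
  · have p1 := (hP z hz).2.1
    have hq := hQ _ (hσmem _ (hfT z hz))
    have p2 := hq.2.1
    by_cases hfx : f z = x
    · refine p1.union p2 ⟨x, hfx ▸ hfP z hz, y, ?_, exy⟩
      have := hq.1
      simpa [hσ, hfx] using this
    · refine p1.union_of_mem p2 (hfP z hz) ?_
      have := hq.1
      simpa [hσ, hfx] using this
  · obtain ⟨t, ht, htQ⟩ := (hQ _ (hσmem _ (hfT z hz))).2.2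
    exact ⟨t, ht, .inr htQ⟩
  · intro z hz w hw hzw
    have hne : σ (f z) ≠ σ (f w) := fun h => hzw (hinj hz hw (hσinj (hfT z hz) (hfT w hw) h))
    refine Set.disjoint_left.2 ?_
    rintro v (h1 | h1) (h2 | h2)
    · exact Set.disjoint_left.1 (hPd z hz w hw hzw) h1 h2
    · exact hne (hcross z hz _ (hσmem _ (hfT w hw)) v h1 h2).symm
    · exact hne (hcross w hw _ (hσmem _ (hfT z hz)) v h2 h1)
    · exact Set.disjoint_left.1 (hQd _ (hσmem _ (hfT z hz)) _ (hσmem _ (hfT w hw)) hne) h1 h2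

variable [Fintype V]

/-- Any separation of `G` with `Z` on the left and `T` on the right has order at least `k`. -/
def Linked (G : SimpleGraph V) (Z T : Finset V) (k : ℕ) : Prop :=
  ∀ X Y : Finset V, X ∪ Y = Finset.univ → Z ⊆ X → T ⊆ Y →
    (∀ u ∈ X, ∀ v ∈ Y, G.Adj u v → u ∈ Y ∨ v ∈ X) → k ≤ (X ∩ Y).card

theorem Linked.keepIn_left {G : SimpleGraph V} {Z T X Y : Finset V} {k : ℕ} {x y : V}
    (h : Linked G Z T k) (hXY : X ∪ Y = Finset.univ) (hZ : Z ⊆ X) (hT : T ⊆ Y)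
    (hsep : ∀ u ∈ X, ∀ v ∈ Y, G.Adj u v → u ∈ Y ∨ v ∈ X ∨ (u = x ∧ v = y)) :
    Linked (keepIn G X) Z (insert x (X ∩ Y)) k := by
  intro X₁ Y₁ h₁ hZ₁ hT₁ hs
  refine (h (X₁ ∩ X) (Y ∪ Y₁) ?_ (Finset.subset_inter hZ₁ hZ)
    (hT.trans Finset.subset_union_left) ?_).trans (Finset.card_le_card ?_)
  · ext v
    have a := Finset.ext_iff.1 hXY v
    have b := Finset.ext_iff.1 h₁ v
    simp only [Finset.mem_union, Finset.mem_univ, iff_true, Finset.mem_inter] at *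
    tauto
  · intro u hu v hv e
    have a := Finset.ext_iff.1 hXY v
    have b := hsep u (Finset.mem_inter.1 hu).2 v
    have c := hs u (Finset.mem_inter.1 hu).1 v
    have d : v ∈ X → v ∈ Y → v ∈ Y₁ := fun p q =>
      hT₁ (Finset.mem_insert_of_mem (Finset.mem_inter.2 ⟨p, q⟩))
    have f : x ∈ Y₁ := hT₁ (Finset.mem_insert_self _ _)
    simp only [Finset.mem_union, Finset.mem_univ, iff_true, Finset.mem_inter, keepIn] at *
    by_cases hvX : v ∈ X
    · have := d hvX
      tauto
    · rcases b (a.resolve_left hvX) e with b | b | ⟨rfl, -⟩ <;> tauto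
  · intro v hv
    simp only [Finset.mem_union, Finset.mem_inter] at *
    refine ⟨hv.1.1, hv.2.elim (fun hY => hT₁ ?_) id⟩
    exact Finset.mem_insert_of_mem (Finset.mem_inter.2 ⟨hv.1.2, hY⟩)

theorem Linked.symm {G : SimpleGraph V} {Z T : Finset V} {k : ℕ} (h : Linked G Z T k) :
    Linked G T Z k := by
  intro X Y hXY hX hY hs
  rw [Finset.inter_comm]
  exact h Y X (by rwa [Finset.union_comm]) hY hX fun u hu v hv e => (hs v hv u hu e.symm).symm

theorem Linked.exists_disjoint {G : SimpleGraph V} {Z T : Finset V} (h : Linked G Z T Z.card) :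
    ∃ P : V → Set V, (∀ z ∈ Z, z ∈ P z ∧ PreconnOn G (P z) ∧ ∃ t ∈ T, t ∈ P z) ∧
      ∀ z ∈ Z, ∀ w ∈ Z, z ≠ w → Disjoint (P z) (P w) := by
  induction hn : (Finset.univ.filter fun p : V × V => G.Adj p.1 p.2).card using
    Nat.strong_induction_on generalizing G Z T with
  | _ n ih =>
  subst hn
  have lt_of : ∀ (G' : SimpleGraph V) (x y : V), G' ≤ G → G.Adj x y → ¬ G'.Adj x y →
      (Finset.univ.filter fun p : V × V => G'.Adj p.1 p.2).card <
        (Finset.univ.filter fun p : V × V => G.Adj p.1 p.2).card := by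
    intro G' x y hle e ne
    refine Finset.card_lt_card ⟨fun p hp => ?_, fun hc => ne ?_⟩
    · simp only [Finset.mem_filter] at *
      exact ⟨hp.1, hle hp.2⟩
    · simpa using hc (Finset.mem_filter.2 ⟨Finset.mem_univ (x, y), e⟩)
  by_cases hE : ∃ x y, G.Adj x y
  swap
  · push Not at hE
    refine ⟨fun z => {z}, fun z hz => ⟨rfl, preconnOn_singleton z, z, ?_, rfl⟩,
      fun z _ w _ hzw => by simpa using hzw⟩
    have := h Z (T ∪ Zᶜ) (by ext v; simp; tauto) subset_rfl Finset.subset_union_left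
      fun u _ v _ e => (hE u v e).elim
    have hZ := Finset.eq_of_subset_of_card_le Finset.inter_subset_left this
    have : z ∈ Z ∩ (T ∪ Zᶜ) := hZ.symm ▸ hz
    simpa [hz] using this
  obtain ⟨a, b, e⟩ := hE
  have hlt := lt_of (G.deleteEdges {s(a, b)}) a b (G.deleteEdges_le _) e (by simp)
  by_cases hdel : Linked (G.deleteEdges {s(a, b)}) Z T Z.card
  · obtain ⟨P, hP, hPd⟩ := ih _ hlt hdel rfl
    exact ⟨P, fun z hz => ⟨(hP z hz).1, (hP z hz).2.1.mono_graph
      fun _ _ _ _ h => G.deleteEdges_le _ h, (hP z hz).2.2⟩, hPd⟩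
  simp only [Linked, not_forall, not_le] at hdel
  obtain ⟨X, Y, hXY, hZ, hT, hs, hcard⟩ := hdel
  obtain ⟨x, y, hx, hy, exy, hs'⟩ : ∃ x y, x ∈ X \ Y ∧ y ∈ Y \ X ∧ G.Adj x y ∧
      ∀ u ∈ X, ∀ v ∈ Y, G.Adj u v → u ∈ Y ∨ v ∈ X ∨ (u = x ∧ v = y) := by
    by_contra hcon
    refine absurd (h X Y hXY hZ hT fun u hu v hv euv => ?_) (by omega)
    by_contra hne
    rw [not_or] at hne
    refine hcon ⟨u, v, by simp [hu, hne], by simp [hv, hne], euv, fun u' hu' v' hv' euv' => ?_⟩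
    have h1 := hs u hu v hv
    have h2 := hs u' hu' v' hv'
    simp only [deleteEdges_adj, Set.mem_singleton_iff, Sym2.eq_iff, euv, euv', true_and] at h1 h2
    by_contra hne'
    simp only [not_or] at hne'
    have h1' : (u = a ∧ v = b) ∨ (u = b ∧ v = a) := by tauto
    have h2' : (u' = a ∧ v' = b) ∨ (u' = b ∧ v' = a) := by tauto
    rcases h1' with ⟨rfl, rfl⟩ | ⟨rfl, rfl⟩ <;> rcases h2' with ⟨rfl, rfl⟩ | ⟨rfl, rfl⟩ <;> tauto
  rw [Finset.mem_sdiff] at hx hy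
  have hYX : Y ∪ X = Finset.univ := by rwa [Finset.union_comm]
  have hs2 : ∀ u ∈ Y, ∀ v ∈ X, G.Adj u v → u ∈ X ∨ v ∈ Y ∨ (u = y ∧ v = x) := by
    intro u hu v hv euv
    have := hs' v hv u hu euv.symm
    tauto
  have l1 := h.keepIn_left hXY hZ hT hs'
  have l2 := (h.symm.keepIn_left hYX hT hZ hs2).symm
  have hx' : x ∉ X ∩ Y := by simp [hx]
  have hy' : y ∉ Y ∩ X := by simp [hy]
  have hc1 : (insert x (X ∩ Y)).card = Z.card := by
    have := h X (insert x Y) ?_ hZ (hT.trans (Finset.subset_insert _ _)) ?_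
    · have h3 : X ∩ insert x Y ⊆ insert x (X ∩ Y) := by
        intro v; simp; tauto
      have := Finset.card_le_card h3
      rw [Finset.card_insert_of_notMem hx'] at *
      omega
    · rw [Finset.union_insert, hXY, Finset.insert_eq_of_mem (Finset.mem_univ _)]
    · intro u hu v hv euv
      simp only [Finset.mem_insert] at *
      rcases hv with rfl | hv
      · exact .inr hx.1
      · have := hs' u hu v hv euv; tauto
  have hc2 : (insert y (Y ∩ X)).card = Z.card := by
    rw [← hc1, Finset.card_insert_of_notMem hx', Finset.card_insert_of_notMem hy',
      Finset.inter_comm]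
  obtain ⟨P, hP, hPd⟩ := ih _ (lt_of (keepIn G X) x y (fun _ _ h => h.1) exy
    fun hh => hy.2 hh.2.2) l1 rfl
  obtain ⟨Q, hQ, hQd⟩ := ih _ (lt_of (keepIn G Y) x y (fun _ _ h => h.1) exy
    fun hh => hx.2 hh.2.1) (hc2.symm ▸ l2) rfl
  have hsub1 : ∀ z ∈ Z, P z ⊆ (X : Set V) := fun z hz =>
    (hP z hz).2.1.subset_keepIn (hP z hz).1 (hZ hz)
  have hsub2 : ∀ s ∈ insert y (Y ∩ X), Q s ⊆ (Y : Set V) := fun s hs =>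
    (hQ s hs).2.1.subset_keepIn (hQ s hs).1 (by
      rcases Finset.mem_insert.1 hs with rfl | h
      exacts [hy.1, (Finset.mem_inter.1 h).1])
  exact exists_disjoint_splice hx.2 hy.2 exy hc1.le
    (fun z hz => ⟨(hP z hz).1, (hP z hz).2.1.mono_graph fun _ _ _ _ h => h.1, (hP z hz).2.2⟩)
    hPd hsub1
    (fun z hz => ⟨(hQ z hz).1, (hQ z hz).2.1.mono_graph fun _ _ _ _ h => h.1, (hQ z hz).2.2⟩)
    hQd hsub2

end DisjointConnections

section RootedModels

open scoped Classical

variable {V : Type}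

/-- Disjoint connected sets `B z` inside `C ∪ {z}`, for `z ∈ N`. -/
def RootedBags (H : SimpleGraph V) (N C : Finset V) (B : V → Set V) : Prop :=
  (∀ z ∈ N, z ∈ B z ∧ B z ⊆ insert z (C : Set V) ∧ PreconnOn H (B z)) ∧
    ∀ z ∈ N, ∀ w ∈ N, z ≠ w → Disjoint (B z) (B w)

/-- A model, rooted at `N`, of the complete bipartite graph with sides `N` and a pair, with the
pair joined by an edge. -/
def RootedBiclique (H : SimpleGraph V) (N C : Finset V) : Prop :=
  ∃ (B : V → Set V) (P Q : Set V), RootedBags H N C B ∧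
    P ⊆ (C : Set V) ∧ Q ⊆ (C : Set V) ∧ PreconnOn H P ∧ PreconnOn H Q ∧ Disjoint P Q ∧
    (∀ z ∈ N, Disjoint (B z) P ∧ Disjoint (B z) Q ∧ Touch H (B z) P ∧ Touch H (B z) Q) ∧
    Touch H P Q

/-- A model, rooted at `N`, of the complete graph on `N`. -/
def RootedClique (H : SimpleGraph V) (N C : Finset V) : Prop :=
  ∃ B : V → Set V, RootedBags H N C B ∧ ∀ z ∈ N, ∀ w ∈ N, z ≠ w → Touch H (B z) (B w)

theorem RootedBiclique.lift {H H' : SimpleGraph V} {N C C' : Finset V} (β : V → Set V)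
    (hβ : ∀ a, PreconnOn H (β a)) (hd : ∀ a b, a ≠ b → Disjoint (β a) (β b))
    (hadj : ∀ a b, H'.Adj a b → Touch H (β a) (β b))
    (hN : ∀ z ∈ N, z ∈ β z ∧ β z ⊆ insert z (C : Set V)) (hC : ∀ a ∈ C', β a ⊆ (C : Set V))
    (h : RootedBiclique H' N C') : RootedBiclique H N C := by
  obtain ⟨B, P, Q, ⟨hB, hBd⟩, hP, hQ, hPc, hQc, hPQ, hBPQ, ht⟩ := h
  have hsub : ∀ S ⊆ (C' : Set V), (⋃ a ∈ S, β a) ⊆ (C : Set V) := fun S hS =>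
    Set.iUnion₂_subset fun a ha => hC a (hS ha)
  refine ⟨fun z => ⋃ a ∈ B z, β a, ⋃ a ∈ P, β a, ⋃ a ∈ Q, β a, ⟨fun z hz => ⟨?_, ?_, ?_⟩, ?_⟩,
    hsub P hP, hsub Q hQ, hPc.biUnion hβ hadj, hQc.biUnion hβ hadj,
    disjoint_biUnion_of_disjoint hd hPQ, fun z hz => ⟨?_, ?_, ?_, ?_⟩, ht.biUnion hadj⟩
  · exact Set.mem_biUnion (hB z hz).1 (hN z hz).1
  · refine Set.iUnion₂_subset fun a ha => ?_
    rcases (hB z hz).2.1 ha with rfl | ha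
    · exact (hN _ hz).2
    · exact (hC a ha).trans (Set.subset_insert _ _)
  · exact (hB z hz).2.2.biUnion hβ hadj
  · exact fun z hz w hw hzw => disjoint_biUnion_of_disjoint hd (hBd z hz w hw hzw)
  · exact disjoint_biUnion_of_disjoint hd (hBPQ z hz).1
  · exact disjoint_biUnion_of_disjoint hd (hBPQ z hz).2.1
  · exact (hBPQ z hz).2.2.1.biUnion hadj
  · exact (hBPQ z hz).2.2.2.biUnion hadj

theorem RootedBiclique.clique {H : SimpleGraph V} {N C : Finset V} (h : RootedBiclique H N C)
    (hN : N.card ≤ 3) : RootedClique H N C := by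
  obtain ⟨B, P, Q, ⟨hB, hBd⟩, hP, hQ, hPc, hQc, hPQ, hBPQ, ht⟩ := h
  obtain ⟨e⟩ := Function.Embedding.nonempty_of_card_le (α := N) (β := Fin 3) (by simpa using hN)
  obtain ⟨f, hf⟩ : ∃ f : V → Fin 3, ∀ z ∈ N, ∀ w ∈ N, z ≠ w → f z ≠ f w := by
    refine ⟨fun v => if h : v ∈ N then e ⟨v, h⟩ else 0, fun z hz w hw hzw h => hzw ?_⟩
    simpa [hz, hw] using h
  let X : Fin 3 → Set V := ![P, Q, ∅]
  have hX : ∀ i, X i = P ∨ X i = Q ∨ X i = ∅ := by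
    intro i; fin_cases i <;> simp [X]
  refine ⟨fun z => B z ∪ X (f z), ⟨fun z hz => ⟨.inl (hB z hz).1, ?_, ?_⟩, ?_⟩, ?_⟩
  · refine Set.union_subset (hB z hz).2.1 (Set.Subset.trans ?_ (Set.subset_insert _ _))
    rcases hX (f z) with h | h | h <;> rw [h]
    exacts [hP, hQ, Set.empty_subset _]
  · beta_reduce
    rcases hX (f z) with h | h | h <;> rw [h]
    · exact (hB z hz).2.2.union hPc (hBPQ z hz).2.2.1
    · exact (hB z hz).2.2.union hQc (hBPQ z hz).2.2.2
    · simpa using (hB z hz).2.2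
  · intro z hz w hw hzw
    have h1 : ∀ a ∈ N, ∀ i, Disjoint (B a) (X i) := by
      intro a ha i
      rcases hX i with h | h | h <;> rw [h]
      exacts [(hBPQ a ha).1, (hBPQ a ha).2.1, Set.disjoint_empty _]
    have h2 : ∀ i j, i ≠ j → Disjoint (X i) (X j) := by
      intro i j hij
      fin_cases i <;> fin_cases j <;> simp [X, hPQ, hPQ.symm] at *
    simp only [Set.disjoint_union_left, Set.disjoint_union_right]
    exact ⟨⟨hBd z hz w hw hzw, h1 w hw _ |>.symm⟩, h1 z hz _, h2 _ _ (hf z hz w hw hzw)⟩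
  · have key : ∀ z ∈ N, ∀ w ∈ N, f z < f w → Touch H (B z ∪ X (f z)) (B w ∪ X (f w)) := by
      intro z hz w hw hlt
      have hz1 := (hBPQ z hz).2.2
      have hw1 := (hBPQ w hw).2.2
      generalize f z = i, f w = j at *
      fin_cases i <;> fin_cases j <;> simp at hlt
      · exact ht.mono Set.subset_union_right Set.subset_union_right
      · exact hw1.1.symm.mono Set.subset_union_right Set.subset_union_left
      · exact hw1.2.symm.mono Set.subset_union_right Set.subset_union_left
    intro z hz w hw hzw
    rcases lt_or_gt_of_ne (hf z hz w hw hzw) with h | h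
    · exact key z hz w hw h
    · exact (key w hw z hz h).symm

variable [Fintype V]

/-- The vertices outside `C` with a neighbour in `C`. -/
noncomputable def nbr (H : SimpleGraph V) (C : Finset V) : Finset V :=
  Finset.univ.filter fun v => v ∉ C ∧ ∃ c ∈ C, H.Adj c v

/-- The ordered pairs of adjacent vertices that meet `C`. -/
noncomputable def pairs (H : SimpleGraph V) (C : Finset V) : Finset (V × V) :=
  Finset.univ.filter fun p => H.Adj p.1 p.2 ∧ (p.1 ∈ C ∨ p.2 ∈ C)

/-- More than `4 |C|` edges meet `C`. -/
def Heavy (H : SimpleGraph V) (C : Finset V) : Prop :=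
  8 * C.card < (pairs H C).card

theorem mem_nbr {H : SimpleGraph V} {C : Finset V} {v : V} :
    v ∈ nbr H C ↔ v ∉ C ∧ ∃ c ∈ C, H.Adj c v := by
  simp [nbr]

theorem mem_pairs {H : SimpleGraph V} {C : Finset V} {p : V × V} :
    p ∈ pairs H C ↔ H.Adj p.1 p.2 ∧ (p.1 ∈ C ∨ p.2 ∈ C) := by
  simp [pairs]

/-- Disjoint connected sets `P q ⊆ (C \ R) ∪ {q}` linking the neighbours `q` of `C` to
neighbours `n q` of `R`, each meeting the neighbourhood of `R` exactly once. -/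
structure Links (H : SimpleGraph V) (R C : Finset V) (P : V → Set V) (n : V → V) : Prop where
  root_mem : ∀ q ∈ nbr H C, q ∈ P q
  subset : ∀ q ∈ nbr H C, P q ⊆ insert q ((C \ R : Finset V) : Set V)
  preconn : ∀ q ∈ nbr H C, PreconnOn H (P q)
  disjoint : ∀ q ∈ nbr H C, ∀ r ∈ nbr H C, q ≠ r → Disjoint (P q) (P r)
  end_nbr : ∀ q ∈ nbr H C, n q ∈ nbr H R
  end_mem : ∀ q ∈ nbr H C, n q ∈ P q
  unique : ∀ q ∈ nbr H C, ∀ v ∈ P q, v ∈ nbr H R → v = n q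

theorem exists_links (H : SimpleGraph V) {R W : Finset V} (hRW : R ⊆ W) :
    ∃ C, R ⊆ C ∧ C ⊆ W ∧ (C = W ∨ (nbr H C).card < (nbr H W).card) ∧
      ∃ P n, Links H R C P n := by
  obtain ⟨C, hRC, hCW, hW, hmin⟩ : ∃ C, R ⊆ C ∧ C ⊆ W ∧
      (C = W ∨ (nbr H C).card < (nbr H W).card) ∧
      ∀ D, R ⊆ D → D ⊆ W → (nbr H C).card ≤ (nbr H D).card := by
    obtain ⟨C, hC, hmin⟩ := Finset.exists_min_image (Finset.univ.filter fun C => R ⊆ C ∧ C ⊆ W)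
      (fun C => (nbr H C).card) ⟨W, by simp [hRW]⟩
    simp only [Finset.mem_filter, Finset.mem_univ, true_and] at hC hmin
    by_cases h : (nbr H C).card < (nbr H W).card
    · exact ⟨C, hC.1, hC.2, .inr h, fun D h1 h2 => hmin D ⟨h1, h2⟩⟩
    · exact ⟨W, hRW, subset_rfl, .inl rfl, fun D h1 h2 => (not_lt.1 h).trans (hmin D ⟨h1, h2⟩)⟩
  refine ⟨C, hRC, hCW, hW, ?_⟩
  have hlink : Linked (keepIn H ((C ∪ nbr H C) \ R)) (nbr H C) (nbr H R) (nbr H C).card := by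
    intro X Y hXY hX hY hs
    refine (hmin (R ∪ (Y \ X) ∩ C) Finset.subset_union_left ?_).trans (Finset.card_le_card ?_)
    · exact Finset.union_subset hRW (Finset.inter_subset_right.trans hCW)
    · intro v hv
      obtain ⟨hvn, c, hc, e⟩ := mem_nbr.1 hv
      simp only [Finset.mem_union, Finset.mem_inter, Finset.mem_sdiff, not_or] at hvn hc
      have hcC : c ∈ C := hc.elim (fun h => hRC h) fun h => h.2
      have hvX : v ∈ X := by
        by_cases hvC : v ∈ C
        · have := Finset.ext_iff.1 hXY v
          simp only [Finset.mem_union, Finset.mem_univ, iff_true] at this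
          tauto
        · exact hX (mem_nbr.2 ⟨hvC, c, hcC, e⟩)
      refine Finset.mem_inter.2 ⟨hvX, ?_⟩
      by_cases hcR : c ∈ R
      · exact hY (mem_nbr.2 ⟨hvn.1, c, hcR, e⟩)
      · have hc' := hc.resolve_left hcR
        refine (hs v hvX c hc'.1.1 ⟨e.symm, ?_, ?_⟩).resolve_right hc'.1.2
        · simp only [Finset.mem_sdiff, Finset.mem_union]
          exact ⟨or_iff_not_imp_left.2 fun hvC => mem_nbr.2 ⟨hvC, c, hcC, e⟩, hvn.1⟩
        · simp [hcC, hcR]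
  obtain ⟨P, hP, hPd⟩ := hlink.exists_disjoint
  have htrim : ∀ q ∈ nbr H C, ∃ Q ⊆ P q, q ∈ Q ∧ PreconnOn H Q ∧ ∃ n,
      Q ∩ (nbr H R : Set V) = {n} := by
    intro q hq
    obtain ⟨h1, h2, t, ht, htP⟩ := hP q hq
    exact (h2.mono_graph fun _ _ _ _ h => h.1).exists_subset_meeting_once h1 htP _ ht
  choose! Q hQP hqQ hQ n hn using htrim
  have hnn : ∀ q ∈ nbr H C, n q ∈ Q q ∩ (nbr H R : Set V) := fun q hq => by
    rw [hn q hq]; rfl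
  refine ⟨Q, n, hqQ, fun q hq v hv => ?_, hQ, fun q hq r hr hqr => ?_, fun q hq => (hnn q hq).2,
    fun q hq => (hnn q hq).1, fun q hq v hv hvR => ?_⟩
  · by_cases hvq : v = q
    · exact .inl hvq
    refine .inr ?_
    have hqn := mem_nbr.1 hq
    have hv' := (hP q hq).2.1.subset_keepIn (hP q hq).1
      (by simp only [Finset.mem_sdiff, Finset.mem_union]
          exact ⟨.inr hq, fun h => hqn.1 (hRC h)⟩) (hQP q hq hv)
    simp only [Finset.coe_sdiff, Finset.coe_union, Set.mem_sdiff, Set.mem_union,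
      Finset.mem_coe] at hv' ⊢
    refine ⟨hv'.1.resolve_right fun hvn => ?_, hv'.2⟩
    exact Set.disjoint_left.1 (hPd v hvn q hq hvq) (hP v hvn).1 (hQP q hq hv)
  · exact (hPd q hq r hr hqr).mono (hQP q hq) (hQP r hr)
  · have : v ∈ Q q ∩ (nbr H R : Set V) := ⟨hv, hvR⟩
    rwa [hn q hq] at this

theorem Links.not_mem {H : SimpleGraph V} {R C : Finset V} {P : V → Set V} {n : V → V}
    (h : Links H R C P n) (hRC : R ⊆ C) {q v : V} (hq : q ∈ nbr H C) (hv : v ∈ P q) : v ∉ R := by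
  intro hvR
  rcases h.subset q hq hv with rfl | h'
  · exact (mem_nbr.1 hq).1 (hRC hvR)
  · exact (Finset.mem_sdiff.1 h').2 hvR

theorem Links.end_injective {H : SimpleGraph V} {R C : Finset V} {P : V → Set V} {n : V → V}
    (h : Links H R C P n) {q r : V} (hq : q ∈ nbr H C) (hr : r ∈ nbr H C) (hqr : q ≠ r) :
    n q ≠ n r := fun e =>
  Set.disjoint_left.1 (h.disjoint q hq r hr hqr) (h.end_mem q hq) (e ▸ h.end_mem r hr)

theorem Links.biclique {H : SimpleGraph V} {R C : Finset V} {L : V → Set V} {n : V → V}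
    (h : Links H R C L n) (hRC : R ⊆ C) (ht : RootedBiclique H (nbr H R) R) :
    RootedBiclique H (nbr H C) C := by
  obtain ⟨B, P, Q, ⟨hB, hBd⟩, hP, hQ, hPc, hQc, hPQ, hBPQ, ht⟩ := ht
  have hdisj : ∀ q ∈ nbr H C, ∀ S ⊆ (R : Set V), Disjoint (L q) S := fun q hq S hS =>
    Set.disjoint_left.2 fun v hv hvS => h.not_mem hRC hq hv (hS hvS)
  have hcross : ∀ q ∈ nbr H C, ∀ r ∈ nbr H C, q ≠ r → Disjoint (L q) (B (n r)) := by
    intro q hq r hr hqr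
    refine Set.disjoint_left.2 fun v hv hvB => ?_
    rcases (hB _ (h.end_nbr r hr)).2.1 hvB with rfl | hvR
    · exact Set.disjoint_left.1 (h.disjoint q hq r hr hqr) hv (h.end_mem r hr)
    · exact h.not_mem hRC hq hv hvR
  refine ⟨fun q => L q ∪ B (n q), P, Q, ⟨fun q hq => ⟨.inl (h.root_mem q hq), ?_, ?_⟩, ?_⟩,
    hP.trans (by exact_mod_cast hRC), hQ.trans (by exact_mod_cast hRC), hPc, hQc, hPQ,
    fun q hq => ?_, ht⟩
  · have hsub : L q ⊆ insert q (C : Set V) :=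
      (h.subset q hq).trans (Set.insert_subset_insert (by simp))
    refine Set.union_subset hsub ((hB _ (h.end_nbr q hq)).2.1.trans ?_)
    exact Set.insert_subset (hsub (h.end_mem q hq))
      ((Finset.coe_subset.2 hRC).trans (Set.subset_insert _ _))
  · exact (h.preconn q hq).union_of_mem (hB _ (h.end_nbr q hq)).2.2 (h.end_mem q hq)
      (hB _ (h.end_nbr q hq)).1
  · intro q hq r hr hqr
    simp only [Set.disjoint_union_left, Set.disjoint_union_right]
    exact ⟨⟨h.disjoint q hq r hr hqr, (hcross r hr q hq hqr.symm).symm⟩, hcross q hq r hr hqr,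
      hBd _ (h.end_nbr q hq) _ (h.end_nbr r hr) (h.end_injective hq hr hqr)⟩
  · obtain ⟨h1, h2, h3, h4⟩ := hBPQ _ (h.end_nbr q hq)
    exact ⟨Set.disjoint_union_left.2 ⟨hdisj q hq P hP, h1⟩,
      Set.disjoint_union_left.2 ⟨hdisj q hq Q hQ, h2⟩,
      h3.mono Set.subset_union_right subset_rfl, h4.mono Set.subset_union_right subset_rfl⟩

end RootedModels

section MassedSets

open scoped Classical

variable {V : Type} [Fintype V]

/-- `W` is heavy, its neighbourhood is inside `Z`, and no subset of `W` with fewer than `|Z|`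
neighbours is heavy. -/
structure Massed (H : SimpleGraph V) (Z W : Finset V) : Prop where
  disjoint : Disjoint Z W
  nbr_subset : nbr H W ⊆ Z
  heavy : Heavy H W
  light : ∀ C ⊆ W, (nbr H C).card < Z.card → ¬ Heavy H C

/-- Massed sets with fewer than `n` vertices and at most four roots have rooted bicliques. -/
def BicliquesBelow (V : Type) [Fintype V] (n : ℕ) : Prop :=
  ∀ (H : SimpleGraph V) (Z W : Finset V), Massed H Z W → Z.card ≤ 4 → W.card < n →
    RootedBiclique H Z W

theorem Massed.nbr_eq {H : SimpleGraph V} {Z W : Finset V} (h : Massed H Z W) : nbr H W = Z := by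
  refine Finset.eq_of_subset_of_card_le h.nbr_subset ?_
  by_contra hlt
  exact h.light W subset_rfl (not_le.1 hlt) h.heavy

theorem disjoint_nbr (H : SimpleGraph V) (C : Finset V) : Disjoint (nbr H C) C :=
  Finset.disjoint_left.2 fun _ h => (mem_nbr.1 h).1

theorem Heavy.nonempty {H : SimpleGraph V} {C : Finset V} (h : Heavy H C) : C.Nonempty := by
  rw [Finset.nonempty_iff_ne_empty]
  rintro rfl
  have : pairs H ∅ = ∅ := by ext; simp [mem_pairs]
  simp [Heavy, this] at h

theorem BicliquesBelow.biclique_or {n : ℕ} (ih : BicliquesBelow V n) {H : SimpleGraph V}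
    {Z W : Finset V} (hZ : Z.card ≤ 4) (hW : W.card < n) (hd : Disjoint Z W)
    (hn : nbr H W ⊆ Z) (hh : Heavy H W) :
    RootedBiclique H Z W ∨ ∃ R ⊆ W, (nbr H R).card < Z.card ∧ Heavy H R ∧
      RootedBiclique H (nbr H R) R := by
  by_cases hl : ∀ C ⊆ W, (nbr H C).card < Z.card → ¬ Heavy H C
  · exact .inl (ih H Z W ⟨hd, hn, hh, hl⟩ hZ hW)
  push Not at hl
  obtain ⟨C, hCW, hC, hCh⟩ := hl
  obtain ⟨R, hR, hmin⟩ := Finset.exists_min_image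
    (Finset.univ.filter fun R => R ⊆ W ∧ (nbr H R).card < Z.card ∧ Heavy H R)
    Finset.card ⟨C, by simp [*]⟩
  simp only [Finset.mem_filter, Finset.mem_univ, true_and] at hR hmin
  refine .inr ⟨R, hR.1, hR.2.1, hR.2.2, ih H _ R ⟨disjoint_nbr H R, subset_rfl, hR.2.2,
    fun D hDR hD hDh => ?_⟩ (by omega) ((Finset.card_le_card hR.1).trans_lt hW)⟩
  have := hmin D ⟨hDR.trans hR.1, hD.trans hR.2.1, hDh⟩
  rw [Finset.eq_of_subset_of_card_le hDR this] at hD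
  exact hD.false

/-- Delete `C` and make its neighbourhood a clique. -/
def cliqueReplace (H : SimpleGraph V) (C : Finset V) : SimpleGraph V where
  Adj a b := a ≠ b ∧ a ∉ C ∧ b ∉ C ∧ (H.Adj a b ∨ (a ∈ nbr H C ∧ b ∈ nbr H C))
  symm := ⟨fun _ _ h => ⟨h.1.symm, h.2.2.1, h.2.1, h.2.2.2.imp Adj.symm And.symm⟩⟩
  loopless := ⟨fun _ h => h.1 rfl⟩

theorem RootedClique.lift_cliqueReplace {H : SimpleGraph V} {C : Finset V}
    (h : RootedClique H (nbr H C) C) {N R D : Finset V} (hN : Disjoint N C)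
    (hRD : R ⊆ D) (hCD : C ⊆ D) (ht : RootedBiclique (cliqueReplace H C) N R) :
    RootedBiclique H N D := by
  obtain ⟨B, ⟨hB, hBd⟩, hBt⟩ := h
  set β : V → Set V := fun a => if a ∈ C then ∅ else if a ∈ nbr H C then B a else {a} with hβ
  have hmem : ∀ a, a ∉ C → a ∈ β a := by
    intro a ha
    by_cases h : a ∈ nbr H C
    · simpa [hβ, ha, h] using (hB a h).1
    · simp [hβ, ha, h]
  have hsub : ∀ a, β a ⊆ insert a (C : Set V) := by
    intro a
    by_cases ha : a ∈ C
    · simp [hβ, ha]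
    by_cases h : a ∈ nbr H C
    · simpa [hβ, ha, h] using (hB a h).2.1
    · simp [hβ, ha, h]
  refine ht.lift β (fun a => ?_) (fun a b hab => ?_) (fun a b e => ?_)
    (fun z hz => ⟨hmem z (Finset.disjoint_left.1 hN hz), (hsub z).trans
      (Set.insert_subset_insert (by exact_mod_cast hCD))⟩)
    (fun a ha => (hsub a).trans (Set.insert_subset (hRD ha) (by exact_mod_cast hCD)))
  · by_cases ha : a ∈ C
    · simpa [hβ, ha] using preconnOn_empty
    by_cases h : a ∈ nbr H C
    · simpa [hβ, ha, h] using (hB a h).2.2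
    · simpa [hβ, ha, h] using preconnOn_singleton a
  · by_cases ha : a ∈ C
    · simp [hβ, ha]
    by_cases hb : b ∈ C
    · simp [hβ, hb]
    by_cases ha' : a ∈ nbr H C <;> by_cases hb' : b ∈ nbr H C
    · simpa [hβ, ha, hb, ha', hb'] using hBd a ha' b hb' hab
    · simp only [hβ, ha, hb, ha', hb', if_true, if_false, Set.disjoint_singleton_right]
      exact fun h => ((hB a ha').2.1 h).elim (fun h => hab h.symm) hb
    · simp only [hβ, ha, hb, ha', hb', if_true, if_false, Set.disjoint_singleton_left]
      exact fun h => ((hB b hb').2.1 h).elim hab ha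
    · simpa [hβ, ha, hb, ha', hb'] using hab
  · obtain ⟨hne, ha, hb, e | ⟨ha', hb'⟩⟩ := e
    · exact ⟨a, hmem a ha, b, hmem b hb, e⟩
    · simpa [hβ, ha, hb, ha', hb'] using hBt a ha' b hb' hne

theorem nbr_cliqueReplace {H : SimpleGraph V} {C R : Finset V} (hR : Disjoint R C)
    {c : V} (hcR : c ∈ R) (hc : c ∈ nbr H C) :
    nbr H (R ∪ C) = nbr (cliqueReplace H C) R := by
  have hRC : ∀ a ∈ R, a ∉ C := fun a h => Finset.disjoint_left.1 hR h
  ext v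
  rw [mem_nbr, mem_nbr]
  constructor
  · rintro ⟨hv, d, hd, e⟩
    rw [Finset.mem_union, not_or] at hv
    refine ⟨hv.1, ?_⟩
    by_cases hdR : d ∈ R
    · exact ⟨d, hdR, e.ne, hRC d hdR, hv.2, .inl e⟩
    · refine ⟨c, hcR, fun h => hv.1 (h ▸ hcR), hRC c hcR, hv.2, .inr ⟨hc, ?_⟩⟩
      exact mem_nbr.2 ⟨hv.2, d, (Finset.mem_union.1 hd).resolve_left hdR, e⟩
  · rintro ⟨hv, d, hd, hne, hdC, hvC, e | e⟩
    · exact ⟨by simp [hv, hvC], d, Finset.mem_union_left _ hd, e⟩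
    · obtain ⟨-, b, hb, e⟩ := mem_nbr.1 e.2
      exact ⟨by simp [hv, hvC], b, Finset.mem_union_right _ hb, e⟩

/-- In a massed set without rooted biclique, no nonempty subset with few neighbours has a
clique model rooted at its neighbourhood. -/
theorem Massed.not_clique {H : SimpleGraph V} {Z W : Finset V} (h : Massed H Z W)
    (hZ : Z.card ≤ 4) (ih : BicliquesBelow V W.card) (hno : ¬ RootedBiclique H Z W)
    {C : Finset V} (hCW : C ⊆ W) (hne : C.Nonempty) (hC : (nbr H C).card < Z.card) :
    ¬ RootedClique H (nbr H C) C := by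
  intro hclique
  obtain ⟨C, hC', hmax⟩ := Finset.exists_max_image (Finset.univ.filter fun C => C ⊆ W ∧
    C.Nonempty ∧ (nbr H C).card < Z.card ∧ RootedClique H (nbr H C) C)
    Finset.card ⟨C, by simp [*]⟩
  clear hCW hne hC hclique
  simp only [Finset.mem_filter, Finset.mem_univ, true_and] at hC' hmax
  obtain ⟨hCW, hne, hC, hclique⟩ := hC'
  have hZC : Disjoint Z C := h.disjoint.mono_right hCW
  have hcard : (W \ C).card + C.card = W.card := Finset.card_sdiff_add_card_eq_card hCW
  have hpos := hne.card_pos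
  have hheavy : Heavy (cliqueReplace H C) (W \ C) := by
    have h1 : pairs H W ⊆ pairs (cliqueReplace H C) (W \ C) ∪ pairs H C := by
      intro p hp
      rw [mem_pairs] at hp
      by_cases hpC : p.1 ∈ C ∨ p.2 ∈ C
      · exact Finset.mem_union_right _ (mem_pairs.2 ⟨hp.1, hpC⟩)
      · rw [not_or] at hpC
        refine Finset.mem_union_left _ (mem_pairs.2 ⟨⟨hp.1.ne, hpC.1, hpC.2, .inl hp.1⟩, ?_⟩)
        simpa [hpC] using hp.2
    have h2 := (Finset.card_le_card h1).trans (Finset.card_union_le _ _)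
    have h3 := h.light C hCW hC
    have h4 := h.heavy
    simp only [Heavy] at *
    omega
  have hn : nbr (cliqueReplace H C) (W \ C) ⊆ Z := by
    intro v hv
    obtain ⟨hv, c, hc, hne, hcC, hvC, e⟩ := mem_nbr.1 hv
    rw [Finset.mem_sdiff] at hv hc
    have hvW : v ∉ W := fun h => hv ⟨h, hvC⟩
    refine h.nbr_subset (mem_nbr.2 ⟨hvW, ?_⟩)
    rcases e with e | e
    · exact ⟨c, hc.1, e⟩
    · obtain ⟨-, d, hd, e⟩ := mem_nbr.1 e.2
      exact ⟨d, hCW hd, e⟩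
  rcases ih.biclique_or hZ (by omega) (h.disjoint.mono_right Finset.sdiff_subset) hn hheavy with
    ht | ⟨R, hRW, hR, hRh, ht⟩
  · exact hno (hclique.lift_cliqueReplace hZC Finset.sdiff_subset hCW ht)
  have hRC : Disjoint R C := Finset.sdiff_disjoint.mono_left hRW
  have hRW' : R ⊆ W := hRW.trans Finset.sdiff_subset
  by_cases hdis : ∃ c ∈ R, c ∈ nbr H C
  · obtain ⟨c, hcR, hc⟩ := hdis
    have heq := nbr_cliqueReplace hRC hcR hc
    rw [← heq] at ht hR
    have := hmax (R ∪ C) ⟨Finset.union_subset hRW' hCW, hne.mono Finset.subset_union_right, hR,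
      (hclique.lift_cliqueReplace ((disjoint_nbr H _).mono_right Finset.subset_union_right)
        Finset.subset_union_left Finset.subset_union_right ht).clique (by omega)⟩
    rw [Finset.card_union_of_disjoint hRC] at this
    have := hRh.nonempty.card_pos
    omega
  · push Not at hdis
    refine h.light R hRW' ((Finset.card_le_card fun v hv => ?_).trans_lt hR)
      (lt_of_lt_of_le hRh (Finset.card_le_card fun p hp => ?_))
    · obtain ⟨hv, c, hc, e⟩ := mem_nbr.1 hv
      have hcC := Finset.disjoint_left.1 hRC hc
      exact mem_nbr.2 ⟨hv, c, hc, e.ne, hcC,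
        fun hvC => hdis c hc (mem_nbr.2 ⟨hcC, v, hvC, e.symm⟩), .inl e⟩
    · obtain ⟨⟨-, -, -, e⟩, hp⟩ := mem_pairs.1 hp
      refine mem_pairs.2 ⟨e.resolve_right fun e => ?_, hp⟩
      exact hp.elim (fun h => hdis _ h e.1) fun h => hdis _ h e.2

/-- A massed set without rooted biclique, whose roots form a clique, and which is minimal. -/
structure MinimalFailure (H : SimpleGraph V) (Z W : Finset V) : Prop extends Massed H Z W where
  card_le : Z.card ≤ 4
  below : BicliquesBelow V W.card
  not_biclique : ¬ RootedBiclique H Z W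
  clique : ∀ a ∈ Z, ∀ b ∈ Z, a ≠ b → H.Adj a b
  minimal : ∀ H' : SimpleGraph V, (∀ a ∈ Z, ∀ b ∈ Z, a ≠ b → H'.Adj a b) → Massed H' Z W →
    (pairs H' W).card < (pairs H W).card → RootedBiclique H' Z W

namespace MinimalFailure

variable {H : SimpleGraph V} {Z W : Finset V}

theorem not_rootedClique (h : MinimalFailure H Z W) {C : Finset V} (hCW : C ⊆ W) (hne : C.Nonempty)
    (hC : (nbr H C).card < Z.card) : ¬ RootedClique H (nbr H C) C :=
  h.toMassed.not_clique h.card_le h.below h.not_biclique hCW hne hC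

theorem not_biclique_of_linked (h : MinimalFailure H Z W) {C : Finset V} (hCW : C ⊆ W) (hne : C.Nonempty)
    (hC : C = W ∨ (nbr H C).card < (nbr H W).card) : ¬ RootedBiclique H (nbr H C) C := by
  intro ht
  have hle := h.card_le
  rcases hC with rfl | hC
  · exact h.not_biclique (h.nbr_eq ▸ ht)
  · rw [h.nbr_eq] at hC
    exact h.not_rootedClique hCW hne hC (ht.clique (by omega))

theorem not_heavy (h : MinimalFailure H Z W) {R : Finset V} (hRW : R ⊂ W) (hR : (nbr H R).card ≤ Z.card) :
    ¬ Heavy H R := by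
  intro hh
  rcases hR.lt_or_eq with hlt | heq
  · exact h.light R hRW.1 hlt hh
  have ht : RootedBiclique H (nbr H R) R :=
    h.below H _ R ⟨disjoint_nbr H R, subset_rfl, hh, fun C hC hCR =>
      h.light C (hC.trans hRW.1) (heq ▸ hCR)⟩ (heq ▸ h.card_le) (Finset.card_lt_card hRW)
  obtain ⟨C, hRC, hCW, hC, P, n, hL⟩ := exists_links H hRW.1
  exact h.not_biclique_of_linked hCW (hh.nonempty.mono hRC) hC (hL.biclique hRC ht)

end MinimalFailure

/-- Contract `x` into `y`, leaving `x` isolated. -/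
def contractInto (H : SimpleGraph V) (x y : V) : SimpleGraph V where
  Adj a b := a ≠ b ∧ a ≠ x ∧ b ≠ x ∧ (H.Adj a b ∨ (a = y ∧ H.Adj x b) ∨ (b = y ∧ H.Adj x a))
  symm := ⟨fun _ _ h => ⟨h.1.symm, h.2.2.1, h.2.1,
    h.2.2.2.elim (fun e => .inl e.symm) fun e => .inr e.symm⟩⟩
  loopless := ⟨fun _ h => h.1 rfl⟩

theorem RootedBiclique.of_contractInto {V : Type} {H : SimpleGraph V} {x y : V} (e : H.Adj x y)
    {N R D : Finset V} (hxN : x ∉ N) (hRD : R ⊆ D) (hxD : x ∈ D)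
    (ht : RootedBiclique (contractInto H x y) N R) : RootedBiclique H N D := by
  set β : V → Set V := fun a => if a = x then ∅ else if a = y then {x, y} else {a} with hβ
  have hmem : ∀ a, a ≠ x → a ∈ β a := by
    intro a ha
    by_cases h : a = y
    · subst h; simp [hβ, ha]
    · simp [hβ, ha, h]
  have hsub : ∀ a, β a ⊆ insert a (D : Set V) := by
    intro a v hv
    simp only [hβ] at hv
    split_ifs at hv
    · exact hv.elim
    · subst a; rcases hv with rfl | rfl
      exacts [.inr hxD, .inl rfl]
    · exact .inl hv
  refine ht.lift β (fun a => ?_) (fun a b hab => ?_) (fun a b eab => ?_)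
    (fun z hz => ⟨hmem z fun h => hxN (h ▸ hz), hsub z⟩)
    (fun a ha => (hsub a).trans (Set.insert_subset (hRD ha) subset_rfl))
  · simp only [hβ]
    split_ifs
    · exact preconnOn_empty
    · exact (preconnOn_singleton x).union (preconnOn_singleton y) ⟨x, rfl, y, rfl, e⟩
    · exact preconnOn_singleton a
  · simp only [hβ, Set.disjoint_left]
    split_ifs <;> grind
  · obtain ⟨hne, ha, hb, eab | ⟨rfl, eab⟩ | ⟨rfl, eab⟩⟩ := eab
    · exact ⟨a, hmem a ha, b, hmem b hb, eab⟩
    · exact ⟨x, by simp [hβ, ha], b, hmem b hb, eab⟩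
    · exact ⟨a, hmem a ha, x, by simp [hβ, hb], eab.symm⟩

theorem nbr_insert_contractInto {H : SimpleGraph V} {x y : V} {R : Finset V} (e : H.Adj x y)
    (hx : x ∉ R) (hy : y ∈ R) : nbr H (insert x R) = nbr (contractInto H x y) R := by
  ext v
  simp only [mem_nbr, Finset.mem_insert, not_or]
  constructor
  · rintro ⟨⟨hvx, hvR⟩, c, rfl | hc, ecv⟩
    · exact ⟨hvR, y, hy, fun h => hvR (h ▸ hy), e.ne', hvx, .inr (.inl ⟨rfl, ecv⟩)⟩
    · exact ⟨hvR, c, hc, ecv.ne, fun h => hx (h ▸ hc), hvx, .inl ecv⟩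
  · rintro ⟨hvR, c, hc, hne, hcx, hvx, ecv | ⟨rfl, ecv⟩ | ⟨rfl, ecv⟩⟩
    · exact ⟨⟨hvx, hvR⟩, c, .inr hc, ecv⟩
    · exact ⟨⟨hvx, hvR⟩, x, .inl rfl, ecv⟩
    · exact (hvR hy).elim

theorem card_pairs_contractInto_le {H : SimpleGraph V} {x y : V} {R : Finset V} (hy : y ∉ R) : (pairs (contractInto H x y) R).card ≤ (pairs H R).card := by
  refine Finset.card_le_card_of_injOn
    (fun p => if H.Adj p.1 p.2 then p else if p.1 = y then (x, p.2) else (p.1, x)) ?_ ?_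
  · rintro ⟨a, b⟩ hp
    obtain ⟨⟨hne, ha, hb, e⟩, hR⟩ := mem_pairs.1 hp
    simp only [] at *
    refine mem_pairs.2 ?_
    split_ifs with h1 h2
    · exact ⟨h1, hR⟩
    · subst h2
      exact ⟨by grind, by grind⟩
    · exact ⟨by grind [Adj.symm], by grind⟩
  · rintro ⟨a, b⟩ hp ⟨c, d⟩ hq hpq
    obtain ⟨⟨hne, ha, hb, e⟩, hR⟩ := mem_pairs.1 hp
    obtain ⟨⟨hne', hc, hd, e'⟩, hR'⟩ := mem_pairs.1 hq
    simp only [Prod.ext_iff] at *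
    split_ifs at hpq <;> grind

/-- Contracting `x` into `y` loses the edges from `x` to `y` and to the common neighbours. -/
theorem card_pairs_le_contractInto {H : SimpleGraph V} {Z W : Finset V} {x y : V}
    (hW : nbr H W ⊆ Z) (hZ : ∀ a ∈ Z, ∀ b ∈ Z, a ≠ b → H.Adj a b) (hx : x ∈ W)
    (e : H.Adj x y) :
    (pairs H W).card ≤ (pairs (contractInto H x y) (W.erase x)).card +
      2 * ((Finset.univ.filter fun w => H.Adj x w ∧ H.Adj y w).card + 1) := by
  set M := insert y (Finset.univ.filter fun w => H.Adj x w ∧ H.Adj y w) with hM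
  have hMc : M.card ≤ (Finset.univ.filter fun w => H.Adj x w ∧ H.Adj y w).card + 1 :=
    Finset.card_insert_le _ _
  have hmemM : ∀ w, w ∈ M ↔ w = y ∨ (H.Adj x w ∧ H.Adj y w) := by simp [hM]
  have hin : ∀ v, H.Adj x v → v ∈ W ∨ v ∈ Z := fun v ev =>
    or_iff_not_imp_left.2 fun hv => hW (mem_nbr.2 ⟨hv, x, hx, ev⟩)
  set E := M.image (fun w => (x, w)) ∪ M.image (fun w => (w, x)) with hE
  have hEc : E.card ≤ 2 * M.card := by
    rw [hE]
    have := Finset.card_union_le (M.image fun w => (x, w)) (M.image fun w => (w, x))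
    have h1 := Finset.card_image_le (s := M) (f := fun w => (x, w))
    have h2 := Finset.card_image_le (s := M) (f := fun w => (w, x))
    omega
  have hmemE : ∀ a b, (a, b) ∈ E ↔ (a = x ∧ b ∈ M) ∨ (b = x ∧ a ∈ M) := by
    intro a b
    simp only [hE, Finset.mem_union, Finset.mem_image, Prod.mk.injEq]
    grind
  have hinj : (pairs H W \ E).card ≤ (pairs (contractInto H x y) (W.erase x)).card := by
    refine Finset.card_le_card_of_injOn
      (fun p => (if p.1 = x then y else p.1, if p.2 = x then y else p.2)) ?_ ?_
    · rintro ⟨a, b⟩ hp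
      rw [Finset.mem_coe, Finset.mem_sdiff, mem_pairs, hmemE, hmemM, hmemM] at hp
      obtain ⟨⟨hab, hpW⟩, hpE⟩ := hp
      rw [Finset.mem_coe, mem_pairs]
      simp only [Finset.mem_erase, contractInto] at *
      have hxy := hin y e
      have hyx := e.ne
      by_cases ha : a = x
      · subst ha
        have hb := hin b hab
        have := hZ y
        have := hab.ne
        simp only [if_true, if_neg this.symm]
        grind
      · by_cases hb : b = x
        · subst hb
          have hb := hin a hab.symm
          have := hZ y
          have := hab.symm
          simp only [if_true, if_neg ha]
          grind
        · have := hab.ne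
          simp only [if_neg ha, if_neg hb]
          grind
    · rintro ⟨a, b⟩ hp ⟨c, d⟩ hq hpq
      rw [Finset.mem_coe, Finset.mem_sdiff, mem_pairs, hmemE, hmemM, hmemM] at hp hq
      have h1 := hp.1.1
      have h2 := hq.1.1
      have h1' := h1.symm
      have h2' := h2.symm
      have h3 := h1.ne
      have h4 := h2.ne
      clear hMc hmemM hmemE hEc hin
      clear_value E M
      simp only [Prod.mk.injEq] at *
      grind
  have := Finset.card_le_card_sdiff_add_card (s := pairs H W) (t := E)
  omega

namespace MinimalFailure

variable {H : SimpleGraph V} {Z W : Finset V}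

theorem four_le_card_common (h : MinimalFailure H Z W) {x y : V} (hx : x ∈ W) (e : H.Adj x y) :
    4 ≤ (Finset.univ.filter fun w => H.Adj x w ∧ H.Adj y w).card := by
  by_contra hlt
  have hxZ : x ∉ Z := fun hZ => Finset.disjoint_left.1 h.disjoint hZ hx
  have hcard := Finset.card_erase_add_one hx
  have hheavy : Heavy (contractInto H x y) (W.erase x) := by
    have h1 := card_pairs_le_contractInto h.nbr_subset h.clique hx e
    have h2 := h.heavy
    simp only [Heavy] at *
    omega
  have hn : nbr (contractInto H x y) (W.erase x) ⊆ Z := by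
    intro v hv
    obtain ⟨hv, c, hc, hne, hcx, hvx, ecv⟩ := mem_nbr.1 hv
    have hvW : v ∉ W := fun h => hv (Finset.mem_erase.2 ⟨hvx, h⟩)
    refine h.nbr_subset (mem_nbr.2 ⟨hvW, ?_⟩)
    rcases ecv with ecv | ⟨-, ecv⟩ | ⟨rfl, -⟩
    · exact ⟨c, Finset.mem_of_mem_erase hc, ecv⟩
    · exact ⟨x, hx, ecv⟩
    · exact ⟨x, hx, e⟩
  rcases h.below.biclique_or h.card_le (by omega)
    (h.disjoint.mono_right (Finset.erase_subset _ _)) hn hheavy with ht | ⟨R, hRW, hR, hRh, ht⟩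
  · exact h.not_biclique (ht.of_contractInto e hxZ (Finset.erase_subset _ _) hx)
  have hxR : x ∉ R := fun hxR => by simpa using hRW hxR
  have hRW' : R ⊆ W := hRW.trans (Finset.erase_subset _ _)
  by_cases hyR : y ∈ R
  · have heq := nbr_insert_contractInto e hxR hyR
    rw [← heq] at hR ht
    have hle := h.card_le
    have hxn : x ∉ nbr H (insert x R) := fun hx =>
      (mem_nbr.1 hx).1 (Finset.mem_insert_self _ _)
    exact h.not_rootedClique (Finset.insert_subset hx hRW') (Finset.insert_nonempty _ _) hR
      ((ht.of_contractInto e hxn (Finset.subset_insert _ _)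
        (Finset.mem_insert_self _ _)).clique (by omega))
  · have hsub : nbr H R ⊆ insert x (nbr (contractInto H x y) R) := by
      intro v hv
      obtain ⟨hvR, c, hc, ecv⟩ := mem_nbr.1 hv
      rw [Finset.mem_insert, or_iff_not_imp_left]
      exact fun hvx => mem_nbr.2 ⟨hvR, c, hc, ecv.ne, fun h => hxR (h ▸ hc), hvx, .inl ecv⟩
    have hle := (Finset.card_le_card hsub).trans (Finset.card_insert_le _ _)
    exact h.not_heavy ⟨hRW', fun h => hxR (h hx)⟩ (by omega)
      (lt_of_lt_of_le hRh (card_pairs_contractInto_le hyR))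

theorem card_pairs_le (h : MinimalFailure H Z W) {u v : V} (hu : u ∈ W) (hv : v ∈ W) (e : H.Adj u v) :
    (pairs H W).card ≤ 8 * W.card + 2 := by
  by_contra hlt
  set H' := H.deleteEdges {s(u, v)} with hH'
  have hadj : ∀ a b, H'.Adj a b ↔ H.Adj a b ∧ ¬ ((a = u ∧ b = v) ∨ (a = v ∧ b = u)) := by
    simp [hH']
  have hpairs : pairs H W ⊆ insert (u, v) (insert (v, u) (pairs H' W)) := by
    rintro ⟨a, b⟩ hp
    simp only [Finset.mem_insert, mem_pairs, hadj, Prod.mk.injEq] at *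
    tauto
  have hcard := (Finset.card_le_card hpairs).trans ((Finset.card_insert_le _ _).trans
    (Nat.succ_le_succ (Finset.card_insert_le _ _)))
  have hsub : ∀ C, pairs H' C ⊆ pairs H C := by
    rintro C ⟨a, b⟩ hp
    simp only [mem_pairs, hadj] at *
    tauto
  have hssub : pairs H' W ⊂ pairs H W := by
    refine ⟨hsub W, fun hc => ?_⟩
    have := hc ((mem_pairs (p := (u, v))).2 ⟨e, .inl hu⟩)
    simp [mem_pairs, hadj] at this
  have hn : nbr H' W = nbr H W := by
    ext w
    simp only [mem_nbr, hadj]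
    grind
  have hcl : ∀ a ∈ Z, ∀ b ∈ Z, a ≠ b → H'.Adj a b := by
    intro a ha b hb hab
    have := Finset.disjoint_left.1 h.disjoint
    rw [hadj]
    exact ⟨h.clique a ha b hb hab, by grind⟩
  have hmassed : Massed H' Z W := by
    refine ⟨h.disjoint, hn ▸ h.nbr_subset, by simp only [Heavy]; omega, fun C hCW hC hCh => ?_⟩
    have hne : C ≠ W := by
      rintro rfl
      rw [hn, h.nbr_eq] at hC
      exact hC.false
    refine h.not_heavy (hCW.ssubset_of_ne hne) ?_ (hCh.trans_le (Finset.card_le_card (hsub C)))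
    have : nbr H C ⊆ insert (if u ∈ C then v else u) (nbr H' C) := by
      intro w hw
      simp only [Finset.mem_insert, mem_nbr, hadj] at *
      grind
    have := (Finset.card_le_card this).trans (Finset.card_insert_le _ _)
    omega
  obtain ⟨B, P, Q, ⟨hB, hBd⟩, hP, hQ, hPc, hQc, hPQ, hBPQ, p, hp, q, hq, ep⟩ :=
    h.minimal H' hcl hmassed (Finset.card_lt_card hssub)
  have hle : H' ≤ H := H.deleteEdges_le _
  have hmono : ∀ S T, Touch H' S T → Touch H S T := fun S T ⟨a, ha, b, hb, e⟩ =>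
    ⟨a, ha, b, hb, hle e⟩
  exact h.not_biclique ⟨B, P, Q, ⟨fun z hz => ⟨(hB z hz).1, (hB z hz).2.1,
    (hB z hz).2.2.mono_graph fun _ _ _ _ e => hle e⟩, hBd⟩, hP, hQ,
    hPc.mono_graph fun _ _ _ _ e => hle e, hQc.mono_graph fun _ _ _ _ e => hle e, hPQ,
    fun z hz => ⟨(hBPQ z hz).1, (hBPQ z hz).2.1, hmono _ _ (hBPQ z hz).2.2.1,
      hmono _ _ (hBPQ z hz).2.2.2⟩, p, hp, q, hq, hle ep⟩

end MinimalFailure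

theorem sum_card_nbr_add_le_card_pairs {H : SimpleGraph V} {Z W : Finset V} (hd : Disjoint Z W) :
    ∑ w ∈ W, (nbr H {w}).card + ∑ z ∈ Z, (W.filter (H.Adj z)).card ≤ (pairs H W).card := by
  rw [← Finset.card_sigma, ← Finset.card_sigma, ← Finset.card_map
      ⟨fun p : Σ _ : V, V => (p.1, p.2), fun p q h => by
        obtain ⟨a, b⟩ := p; obtain ⟨c, d⟩ := q; simp_all⟩, ← Finset.card_map (s := Z.sigma _)
      ⟨fun p : Σ _ : V, V => (p.1, p.2), fun p q h => by
        obtain ⟨a, b⟩ := p; obtain ⟨c, d⟩ := q; simp_all⟩, ← Finset.card_union_of_disjoint]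
  · refine Finset.card_le_card fun p hp => ?_
    simp only [Finset.mem_union, Finset.mem_map, Finset.mem_sigma, mem_nbr,
      Finset.mem_filter, Finset.mem_singleton] at hp
    rw [mem_pairs]
    rcases hp with ⟨⟨a, b⟩, ⟨ha, -, c, rfl, e⟩, rfl⟩ | ⟨⟨a, b⟩, ⟨-, hb, e⟩, rfl⟩
    exacts [⟨e, .inl ha⟩, ⟨e, .inr hb⟩]
  · rw [Finset.disjoint_left]
    intro p hp hq
    simp only [Finset.mem_map, Finset.mem_sigma] at hp hq
    obtain ⟨⟨a, b⟩, ⟨ha, -⟩, rfl⟩ := hp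
    obtain ⟨⟨c, d⟩, ⟨hc, -⟩, h⟩ := hq
    obtain ⟨rfl, -⟩ := Prod.mk.inj h
    exact Finset.disjoint_left.1 hd hc ha

namespace MinimalFailure

variable {H : SimpleGraph V} {Z W : Finset V}

theorem nonempty (h : MinimalFailure H Z W) : Z.Nonempty := by
  rw [Finset.nonempty_iff_ne_empty]
  rintro rfl
  have hW : ∀ a ∈ W, ∀ b, H.Adj a b → b ∈ W := fun a ha b e => by
    by_contra hb
    simpa [h.nbr_eq] using mem_nbr.2 ⟨hb, a, ha, e⟩
  obtain ⟨⟨a, b⟩, hp⟩ : (pairs H W).Nonempty :=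
    Finset.card_pos.1 (pos_of_gt h.heavy)
  obtain ⟨e, hab⟩ := mem_pairs.1 hp
  have ha : a ∈ W := hab.elim id fun hb => hW b hb a e.symm
  have hb : b ∈ W := hW a ha b e
  refine h.not_biclique ⟨fun _ => ∅, {a}, {b}, ⟨by simp, by simp⟩, by simpa, by simpa,
    preconnOn_singleton a, preconnOn_singleton b, by simpa using e.ne, by simp,
    a, rfl, b, rfl, e⟩

theorem le_card_filter_adj (h : MinimalFailure H Z W) {z : V} (hz : z ∈ Z) :
    6 ≤ (W.filter (H.Adj z)).card + Z.card ∧ ∃ a ∈ W, ∃ b ∈ W, H.Adj a b := by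
  rw [← h.nbr_eq] at hz
  obtain ⟨hzW, w, hw, e⟩ := mem_nbr.1 hz
  rw [h.nbr_eq] at hz
  have h4 := h.four_le_card_common hw e
  set M := Finset.univ.filter fun a => H.Adj w a ∧ H.Adj z a with hM
  have hmem : ∀ a, a ∈ M ↔ H.Adj w a ∧ H.Adj z a := by simp [hM]
  have hMZ : (M \ W).card ≤ (Z.erase z).card := by
    refine Finset.card_le_card fun a ha => ?_
    obtain ⟨ha, haW⟩ := Finset.mem_sdiff.1 ha
    rw [hmem] at ha
    exact Finset.mem_erase.2 ⟨ha.2.ne', h.nbr_subset (mem_nbr.2 ⟨haW, w, hw, ha.1⟩)⟩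
  have hsub : insert w (M ∩ W) ⊆ W.filter (H.Adj z) := by
    intro a ha
    simp only [Finset.mem_insert, Finset.mem_inter, hmem, Finset.mem_filter] at *
    rcases ha with rfl | ⟨⟨-, e'⟩, ha⟩
    exacts [⟨hw, e.symm⟩, ⟨ha, e'⟩]
  have hle := Finset.card_le_card hsub
  rw [Finset.card_insert_of_notMem (by simp [hmem])] at hle
  have := Finset.card_sdiff_add_card_inter M W
  have := Finset.card_erase_add_one hz
  have := h.card_le
  refine ⟨by omega, ?_⟩
  obtain ⟨a, ha⟩ : (M ∩ W).Nonempty := Finset.card_pos.1 (by omega)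
  rw [Finset.mem_inter, hmem] at ha
  exact ⟨w, hw, a, ha.2, ha.1.1⟩

theorem exists_card_nbr_le (h : MinimalFailure H Z W) : ∃ v ∈ W, (nbr H {v}).card ≤ 7 := by
  by_contra! hdeg
  obtain ⟨z, hz⟩ := h.nonempty
  obtain ⟨-, a, ha, b, hb, e⟩ := h.le_card_filter_adj hz
  have h1 := h.card_pairs_le ha hb e
  have h2 := sum_card_nbr_add_le_card_pairs (H := H) h.disjoint
  have h3 : W.card * 8 ≤ ∑ w ∈ W, (nbr H {w}).card := by
    simpa using Finset.card_nsmul_le_sum W (fun w => (nbr H {w}).card) 8 fun w hw => hdeg w hw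
  have h4 : Z.card * (6 - Z.card) ≤ ∑ z ∈ Z, (W.filter (H.Adj z)).card := by
    simpa using Finset.card_nsmul_le_sum Z (fun z => (W.filter (H.Adj z)).card) (6 - Z.card)
      fun z hz => by have := (h.le_card_filter_adj hz).1; omega
  have h5 := h.card_le
  have h6 := Finset.card_pos.2 ⟨z, hz⟩
  interval_cases Z.card <;> omega

theorem nonempty_nbr (h : MinimalFailure H Z W) {v : V} (hv : v ∈ W) : (nbr H {v}).Nonempty := by
  by_contra hne
  have hiso : ∀ w, ¬ H.Adj v w := fun w e =>
    hne ⟨w, mem_nbr.2 ⟨by simpa using e.ne', v, by simp, e⟩⟩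
  have hp : pairs H W ⊆ pairs H (W.erase v) := by
    intro p hp
    obtain ⟨e, hp⟩ := mem_pairs.1 hp
    refine mem_pairs.2 ⟨e, ?_⟩
    have h1 : p.1 ≠ v := fun h1 => hiso p.2 (h1 ▸ e)
    have h2 : p.2 ≠ v := fun h2 => hiso p.1 (h2 ▸ e.symm)
    simpa [h1, h2] using hp
  have hn : nbr H (W.erase v) ⊆ Z := by
    intro w hw
    obtain ⟨hw, c, hc, e⟩ := mem_nbr.1 hw
    have hwv : w ≠ v := fun hwv => hiso c (hwv ▸ e.symm)
    exact h.nbr_subset (mem_nbr.2 ⟨fun hwW => hw (Finset.mem_erase.2 ⟨hwv, hwW⟩), c,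
      Finset.mem_of_mem_erase hc, e⟩)
  refine h.not_heavy (Finset.erase_ssubset hv) (Finset.card_le_card hn) ?_
  have := h.heavy
  have := Finset.card_le_card hp
  have := Finset.card_erase_le (s := W) (a := v)
  simp only [Heavy] at *
  omega

theorem four_le_card_nbr_filter (h : MinimalFailure H Z W) {v n : V} (hv : v ∈ W) (hn : n ∈ nbr H {v}) :
    4 ≤ ((nbr H {v}).filter (H.Adj n)).card := by
  obtain ⟨-, c, hc, e⟩ := mem_nbr.1 hn
  obtain rfl := Finset.mem_singleton.1 hc
  refine (h.four_le_card_common hv e).trans (Finset.card_le_card fun a ha => ?_)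
  simp only [Finset.mem_filter, Finset.mem_univ, true_and, mem_nbr, Finset.mem_singleton,
    exists_eq_left] at *
  exact ⟨⟨ha.1.ne', ha.1⟩, ha.2⟩

/-- If `N \ M` has at most three vertices, then some connected subset of it is adjacent to every
vertex in `M`. -/
theorem exists_dominating (h : MinimalFailure H Z W) {v : V} (hv : v ∈ W) {M : Finset V} (hM : M ⊆ nbr H {v})
    (hM4 : M.card = 4) (hN : (nbr H {v}).card ≤ 7) :
    ∃ D ⊆ nbr H {v} \ M, D.Nonempty ∧ PreconnOn H (D : Set V) ∧ ∀ m ∈ M, ∃ d ∈ D, H.Adj m d := by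
  set N := nbr H {v} with hNdef
  have hS : (N \ M).card ≤ 3 := by rw [Finset.card_sdiff_of_subset hM]; omega
  have hsplit : ∀ n, (N.filter (H.Adj n)) = ((N \ M).filter (H.Adj n)) ∪ (M.filter (H.Adj n)) := by
    intro n
    rw [← Finset.filter_union, Finset.sdiff_union_of_subset hM]
  have hM' : ∀ m ∈ M, ∃ d ∈ N \ M, H.Adj m d := by
    intro m hm
    by_contra! hno
    have h4 := h.four_le_card_nbr_filter hv (hM hm)
    rw [← hNdef, hsplit, Finset.filter_false_of_mem hno, Finset.empty_union] at h4
    have : M.filter (H.Adj m) ⊆ M.erase m := fun a ha => by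
      obtain ⟨ha, e⟩ := Finset.mem_filter.1 ha
      exact Finset.mem_erase.2 ⟨e.ne', ha⟩
    have := Finset.card_le_card this
    have := Finset.card_erase_add_one hm
    omega
  by_cases hs : ∃ s ∈ N \ M, ∀ t ∈ N \ M, ¬ H.Adj s t
  · obtain ⟨s, hs, hno⟩ := hs
    refine ⟨{s}, by simpa using hs, by simp, by simpa using preconnOn_singleton s, fun m hm => ?_⟩
    have h4 := h.four_le_card_nbr_filter hv (Finset.mem_sdiff.1 hs).1
    rw [← hNdef, hsplit, Finset.filter_false_of_mem hno, Finset.empty_union, ← hM4] at h4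
    have := Finset.eq_of_subset_of_card_le (Finset.filter_subset _ _) h4
    rw [← this] at hm
    exact ⟨s, by simp, (Finset.mem_filter.1 hm).2.symm⟩
  · push Not at hs
    obtain ⟨m, hm⟩ : M.Nonempty := Finset.card_pos.1 (by omega)
    obtain ⟨d, hd, -⟩ := hM' m hm
    refine ⟨N \ M, subset_rfl, ⟨d, hd⟩, fun a ha b hb => ?_, hM'⟩
    obtain ⟨c, hc, eac⟩ := hs a ha
    obtain ⟨d, hd, ebd⟩ := hs b hb
    by_cases hab : a = b
    · exact hab ▸ .refl
    by_cases eab : H.Adj a b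
    · exact .single ⟨eab, ha, hb⟩
    have hcd : c = d := by
      by_contra hcd
      have had : a ≠ d := fun h => eab (h ▸ ebd.symm)
      have hbc : b ≠ c := fun h => eab (h ▸ eac)
      have : ({a, b, c, d} : Finset V) ⊆ N \ M := by
        simp only [Finset.insert_subset_iff, Finset.singleton_subset_iff]
        exact ⟨ha, hb, hc, hd⟩
      have := Finset.card_le_card this
      rw [Finset.card_insert_of_notMem (by simp [hab, eac.ne, had]),
        Finset.card_insert_of_notMem (by simp [hbc, ebd.ne]),
        Finset.card_insert_of_notMem (by simpa using hcd), Finset.card_singleton] at this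
      omega
    subst hcd
    exact .tail (.single ⟨eac, ha, hc⟩) ⟨ebd.symm, hc, hb⟩

theorem false (h : MinimalFailure H Z W) : False := by
  obtain ⟨v, hv, hN7⟩ := h.exists_card_nbr_le
  obtain ⟨u, hu⟩ := h.nonempty_nbr hv
  have hvu : ∀ u, u ∈ nbr H {v} ↔ H.Adj v u := fun u => by
    simp only [mem_nbr, Finset.mem_singleton, exists_eq_left]
    exact ⟨fun h => h.2, fun h => ⟨h.ne', h⟩⟩
  have hN5 : 5 ≤ (nbr H {v}).card := by
    have h4 := h.four_le_card_nbr_filter hv hu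
    have : (nbr H {v}).filter (H.Adj u) ⊆ (nbr H {v}).erase u := fun a ha => by
      obtain ⟨ha, e⟩ := Finset.mem_filter.1 ha
      exact Finset.mem_erase.2 ⟨e.ne', ha⟩
    have := Finset.card_le_card this
    have := Finset.card_erase_add_one hu
    omega
  obtain ⟨C, hvC, hCW, hC, P, n, hL⟩ := exists_links H (Finset.singleton_subset_iff.2 hv)
  rw [Finset.singleton_subset_iff] at hvC
  have hC4 : (nbr H C).card ≤ 4 := by
    refine le_trans ?_ h.card_le
    rw [← h.nbr_eq]
    rcases hC with rfl | hC
    exacts [le_rfl, hC.le]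
  obtain ⟨M, hM, hMN, hM4⟩ := Finset.exists_subsuperset_card_eq
    (Finset.image_subset_iff.2 hL.end_nbr) (Finset.card_image_le.trans hC4) (by omega)
  obtain ⟨D, hDN, ⟨d, hd⟩, hDc, hDM⟩ := h.exists_dominating hv hMN hM4 hN7
  have hnM : ∀ q ∈ nbr H C, n q ∈ M := fun q hq => hM (Finset.mem_image_of_mem n hq)
  have hDP : ∀ q ∈ nbr H C, ∀ d ∈ D, d ∉ P q := fun q hq d hd hdq => by
    obtain ⟨hdN, hdM⟩ := Finset.mem_sdiff.1 (hDN hd)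
    exact hdM (hL.unique q hq d hdq hdN ▸ hnM q hq)
  have hvd : ∀ d ∈ D, H.Adj v d := fun d hd => (hvu d).1 (Finset.mem_sdiff.1 (hDN hd)).1
  have hDC : ∀ d ∈ D, d ∈ C := fun d hd => by
    by_contra hdC
    have hq : d ∈ nbr H C := mem_nbr.2 ⟨hdC, v, hvC, hvd d hd⟩
    exact hDP d hq d hd (hL.root_mem d hq)
  refine h.not_biclique_of_linked hCW ⟨v, hvC⟩ hC ⟨P, {v}, D, ⟨fun q hq => ⟨hL.root_mem q hq,
    (hL.subset q hq).trans (Set.insert_subset_insert ?_), hL.preconn q hq⟩, hL.disjoint⟩,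
    by simpa using hvC, fun d hd => hDC d hd, preconnOn_singleton v, hDc, ?_, fun q hq => ⟨?_, ?_,
    ⟨n q, hL.end_mem q hq, v, rfl, ((hvu _).1 (hL.end_nbr q hq)).symm⟩, ?_⟩,
    v, rfl, d, hd, hvd d hd⟩
  · exact Finset.coe_subset.2 Finset.sdiff_subset
  · simpa using fun hvD => (hvd v hvD).ne rfl
  · refine Set.disjoint_singleton_right.2 fun hvq => ?_
    exact hL.not_mem (Finset.singleton_subset_iff.2 hvC) hq hvq (Finset.mem_singleton_self v)
  · exact Set.disjoint_right.2 fun d hd => hDP q hq d hd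
  · obtain ⟨d, hd, e⟩ := hDM _ (hnM q hq)
    exact ⟨n q, hL.end_mem q hq, d, hd, e⟩

end MinimalFailure

/-- Make `Z` a clique. -/
def addClique (H : SimpleGraph V) (Z : Finset V) : SimpleGraph V where
  Adj a b := H.Adj a b ∨ (a ≠ b ∧ a ∈ Z ∧ b ∈ Z)
  symm := ⟨fun _ _ h => h.imp Adj.symm fun h => ⟨h.1.symm, h.2.2, h.2.1⟩⟩
  loopless := ⟨fun _ h => h.elim (fun h => h.ne rfl) fun h => h.1 rfl⟩

theorem nbr_addClique {H : SimpleGraph V} {Z C : Finset V} (hd : Disjoint Z C) :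
    nbr (addClique H Z) C = nbr H C := by
  have := Finset.disjoint_left.1 hd
  ext v
  simp only [mem_nbr, addClique]
  grind

theorem pairs_addClique {H : SimpleGraph V} {Z C : Finset V} (hd : Disjoint Z C) :
    pairs (addClique H Z) C = pairs H C := by
  have := Finset.disjoint_left.1 hd
  ext v
  simp only [mem_pairs, addClique]
  grind

theorem RootedBiclique.of_addClique {V : Type} {H : SimpleGraph V} {Z W : Finset V} (hd : Disjoint Z W)
    (h : RootedBiclique (addClique H Z) Z W) : RootedBiclique H Z W := by
  obtain ⟨B, P, Q, ⟨hB, hBd⟩, hP, hQ, hPc, hQc, hPQ, hBPQ, p, hp, q, hq, e⟩ := h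
  have hdis := Finset.disjoint_left.1 hd
  have hW : ∀ a b, b ∈ W → (addClique H Z).Adj a b → H.Adj a b := fun a b hb e =>
    e.elim id fun e => (hdis e.2.2 hb).elim
  refine ⟨B, P, Q, ⟨fun z hz => ⟨(hB z hz).1, (hB z hz).2.1, (hB z hz).2.2.mono_graph
    fun a ha b hb e => ?_⟩, hBd⟩, hP, hQ, hPc.mono_graph fun a ha b hb e => hW a b (hP hb) e,
    hQc.mono_graph fun a ha b hb e => hW a b (hQ hb) e, hPQ, fun z hz => ⟨(hBPQ z hz).1,
    (hBPQ z hz).2.1, ?_, ?_⟩, p, hp, q, hq, hW p q (hQ hq) e⟩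
  · rcases (hB z hz).2.1 hb with rfl | hb
    · rcases (hB _ hz).2.1 ha with rfl | ha
      · exact (e.ne rfl).elim
      · exact (hW _ _ ha e.symm).symm
    · exact hW a b hb e
  · obtain ⟨a, ha, b, hb, e⟩ := (hBPQ z hz).2.2.1
    exact ⟨a, ha, b, hb, hW a b (hP hb) e⟩
  · obtain ⟨a, ha, b, hb, e⟩ := (hBPQ z hz).2.2.2
    exact ⟨a, ha, b, hb, hW a b (hQ hb) e⟩

theorem bicliquesBelow (V : Type) [Fintype V] (n : ℕ) : BicliquesBelow V n := by
  induction n with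
  | zero => exact fun _ _ _ _ _ h => (Nat.not_lt_zero _ h).elim
  | succ n ih =>
    intro H Z W hm hZ hW
    rcases (Nat.lt_succ_iff.1 hW).lt_or_eq with hW | rfl
    · exact ih H Z W hm hZ hW
    by_contra hno
    have hm' : Massed (addClique H Z) Z W :=
      ⟨hm.disjoint, (nbr_addClique hm.disjoint).le.trans hm.nbr_subset,
        by simpa only [Heavy, pairs_addClique hm.disjoint] using hm.heavy, fun C hC => by
        have hd := hm.disjoint.mono_right hC
        simpa only [Heavy, pairs_addClique hd, nbr_addClique hd] using hm.light C hC⟩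
    obtain ⟨H', ⟨hcl, hH', hno'⟩, hmin⟩ := WellFounded.has_min
      (InvImage.wf (fun H' : SimpleGraph V => (pairs H' W).card) wellFounded_lt)
      {H' | (∀ a ∈ Z, ∀ b ∈ Z, a ≠ b → H'.Adj a b) ∧ Massed H' Z W ∧ ¬ RootedBiclique H' Z W}
      ⟨addClique H Z, fun a ha b hb hab => .inr ⟨hab, ha, hb⟩, hm',
        fun ht => hno (ht.of_addClique hm.disjoint)⟩
    exact MinimalFailure.false ⟨hH', hZ, ih, hno', hcl, fun H'' hcl' hm'' hlt =>
      by_contra fun hno'' => hmin H'' ⟨hcl', hm'', hno''⟩ hlt⟩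

/-- A massed set with at most four roots has a rooted biclique. -/
theorem Massed.biclique {H : SimpleGraph V} {Z W : Finset V} (h : Massed H Z W)
    (hZ : Z.card ≤ 4) : RootedBiclique H Z W :=
  bicliquesBelow V _ H Z W h hZ (Nat.lt_succ_self _)

end MassedSets

section FourSeparations

open scoped Classical

variable {V : Type} [Fintype V]

/-- A model, rooted at `N`, of the complete graph on `N` with an added dominating vertex. -/
def RootedApexClique (H : SimpleGraph V) (N C : Finset V) : Prop :=
  ∃ (B : V → Set V) (P : Set V), RootedBags H N C B ∧
    (∀ z ∈ N, ∀ w ∈ N, z ≠ w → Touch H (B z) (B w)) ∧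
    P ⊆ (C : Set V) ∧ P.Nonempty ∧ PreconnOn H P ∧ ∀ z ∈ N, Disjoint (B z) P ∧ Touch H (B z) P

theorem isMinor_K7vee {V : Type} {G : SimpleGraph V} {Z W W' : Finset V} (hZ : Z.card = 4)
    (hWW' : Disjoint W W') (hZW : Disjoint Z W) (hZW' : Disjoint Z W')
    (ha : RootedApexClique G Z W) (hb : RootedBiclique G Z W') : IsMinor K7vee G := by
  obtain ⟨L, R, ⟨hL, hLd⟩, hLt, hR, hRne, hRc, hLR⟩ := ha
  obtain ⟨B, P, Q, ⟨hB, hBd⟩, hP, hQ, hPc, hQc, hPQ, hBPQ, ht⟩ := hb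
  obtain ⟨p, hp, q, hq, epq⟩ := id ht
  let e : Fin 4 ≃ Z := (Finset.equivFinOfCardEq hZ).symm
  let M : Fin 4 → Set V := fun k => L (e k) ∪ B (e k)
  have hW := Finset.disjoint_left.1 hWW'
  have hMM : ∀ k l, k ≠ l → Disjoint (M k) (M l) := by
    intro k l hkl
    have hne : (e k : V) ≠ e l := fun h => hkl (e.injective (Subtype.ext h))
    have hcross : ∀ z ∈ Z, ∀ w ∈ Z, z ≠ w → Disjoint (L z) (B w) := by
      refine fun z hz w hw hzw => Set.disjoint_left.2 fun v hv hvB => ?_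
      rcases (hB w hw).2.1 hvB with rfl | hvW'
      · exact Set.disjoint_left.1 (hLd z hz _ hw hzw) hv (hL _ hw).1
      · rcases (hL z hz).2.1 hv with rfl | hvW
        exacts [Finset.disjoint_left.1 hZW' hz hvW', hW hvW hvW']
    simp only [M, Set.disjoint_union_left, Set.disjoint_union_right]
    exact ⟨⟨hLd _ (e k).2 _ (e l).2 hne, (hcross _ (e l).2 _ (e k).2 hne.symm).symm⟩,
      hcross _ (e k).2 _ (e l).2 hne, hBd _ (e k).2 _ (e l).2 hne⟩
  have hMR : ∀ k, Disjoint (M k) R := by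
    refine fun k => Set.disjoint_union_left.2 ⟨(hLR _ (e k).2).1, Set.disjoint_left.2 ?_⟩
    intro v hv hvR
    rcases (hB _ (e k).2).2.1 hv with rfl | hvW'
    exacts [Finset.disjoint_left.1 hZW (e k).2 (hR hvR), hW (hR hvR) hvW']
  have hLS : ∀ k, ∀ S ⊆ (W' : Set V), Disjoint (L (e k)) S := by
    refine fun k S hS => Set.disjoint_left.2 fun v hv hvS => ?_
    rcases (hL _ (e k).2).2.1 hv with rfl | hvW
    exacts [Finset.disjoint_left.1 hZW' (e k).2 (hS hvS), hW hvW (hS hvS)]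
  have hRS : ∀ S ⊆ (W' : Set V), Disjoint R S := fun S hS =>
    Set.disjoint_left.2 fun v hv hvS => hW (hR hv) (hS hvS)
  let X : Fin 3 → Set V := ![R, P, Q]
  have hMX : ∀ k i, Disjoint (M k) (X i) ∧ Touch G (M k) (X i) := by
    intro k i
    fin_cases i
    · exact ⟨hMR k, (hLR _ (e k).2).2.mono Set.subset_union_left subset_rfl⟩
    · exact ⟨Set.disjoint_union_left.2 ⟨hLS k P hP, (hBPQ _ (e k).2).1⟩,
        (hBPQ _ (e k).2).2.2.1.mono Set.subset_union_right subset_rfl⟩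
    · exact ⟨Set.disjoint_union_left.2 ⟨hLS k Q hQ, (hBPQ _ (e k).2).2.1⟩,
        (hBPQ _ (e k).2).2.2.2.mono Set.subset_union_right subset_rfl⟩
  let s : Fin 3 ⊕ Fin 4 ≃ Fin 7 := finSumFinEquiv
  have key : ∀ i j : Fin 3 ⊕ Fin 4, i ≠ j →
      Disjoint (Sum.elim X M i) (Sum.elim X M j) ∧
      (K7vee.Adj (s i) (s j) →
        Touch G (Sum.elim X M i) (Sum.elim X M j)) := by
    rintro (i | k) (j | l) hij
    · have h01 : ¬ K7vee.Adj 0 1 := by simp [K7vee]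
      have h02 : ¬ K7vee.Adj 0 2 := by simp [K7vee]
      fin_cases i <;> fin_cases j
      · exact (hij rfl).elim
      · exact ⟨hRS P hP, fun h => (h01 h).elim⟩
      · exact ⟨hRS Q hQ, fun h => (h02 h).elim⟩
      · exact ⟨(hRS P hP).symm, fun h => (h01 h.symm).elim⟩
      · exact (hij rfl).elim
      · exact ⟨hPQ, fun _ => ht⟩
      · exact ⟨(hRS Q hQ).symm, fun h => (h02 h.symm).elim⟩
      · exact ⟨hPQ.symm, fun _ => ht.symm⟩
      · exact (hij rfl).elim
    · exact ⟨(hMX l i).1.symm, fun _ => (hMX l i).2.symm⟩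
    · exact ⟨(hMX k j).1, fun _ => (hMX k j).2⟩
    · have hkl : k ≠ l := fun h => hij (h ▸ rfl)
      refine ⟨hMM k l hkl, fun _ => (hLt _ (e k).2 _ (e l).2 fun h =>
        hkl (e.injective (Subtype.ext h))).mono Set.subset_union_left Set.subset_union_left⟩
  refine ⟨fun i => Sum.elim X M (s.symm i), fun i => ?_, fun i j hij => ?_,
    fun i j hij => ?_⟩
  · rw [induce_connected_iff]
    beta_reduce
    rcases s.symm i with i | k
    · fin_cases i
      exacts [⟨hRne, hRc⟩, ⟨⟨p, hp⟩, hPc⟩, ⟨⟨q, hq⟩, hQc⟩]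
    · exact ⟨⟨e k, .inl (hL _ (e k).2).1⟩, (hL _ (e k).2).2.2.union_of_mem (hB _ (e k).2).2.2
        (hL _ (e k).2).1 (hB _ (e k).2).1⟩
  · exact (key _ _ fun h => hij (s.symm.injective h)).1
  · exact (key _ _ fun h => hij.ne (s.symm.injective h)).2 (by simpa using hij)

theorem card_pairs_univ (H : SimpleGraph V) :
    (pairs H Finset.univ).card = 2 * H.edgeSet.ncard := by
  have h1 := H.dart_card_eq_twice_card_edges
  rw [← Set.ncard_coe_finset, SimpleGraph.coe_edgeFinset] at h1
  rw [← h1, ← Finset.card_univ, ← Finset.card_map ⟨_, SimpleGraph.Dart.toProd_injective⟩]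
  congr 1
  ext p
  simp only [mem_pairs, Finset.mem_univ, or_self, and_true, Finset.mem_map, true_and]
  exact ⟨fun e => ⟨⟨p, e⟩, rfl⟩, fun ⟨d, h⟩ => h ▸ d.adj⟩

/-- The vertices outside `B`. -/
noncomputable def off (B : Set V) : Finset V := Finset.univ.filter (· ∉ B)

theorem mem_off {B : Set V} {v : V} : v ∈ off B ↔ v ∉ B := by simp [off]

/-- The graph on `A` obtained from `G[A]` by making `A ∩ B` a clique. -/
def sideGraph (G : SimpleGraph V) (A B : Set V) : SimpleGraph A where
  Adj a b := a ≠ b ∧ (G.Adj a b ∨ ((a : V) ∈ B ∧ (b : V) ∈ B))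
  symm := ⟨fun _ _ h => ⟨h.1.symm, h.2.imp Adj.symm And.symm⟩⟩
  loopless := ⟨fun _ h => h.1 rfl⟩

theorem HasRootedK4Model.exists_bags {V : Type} {G : SimpleGraph V} {A B : Set V}
    (h : HasRootedK4Model (G.induce B) {x : ↥B | (x : V) ∈ A}) :
    ∃ β : V → Set V, (∀ z ∈ A ∩ B, z ∈ β z ∧ (∀ v ∈ β z, v ∈ A → v = z) ∧ PreconnOn G (β z)) ∧
      ∀ z ∈ A ∩ B, ∀ w ∈ A ∩ B, z ≠ w → Disjoint (β z) (β w) ∧ Touch G (β z) (β w) := by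
  obtain ⟨M, hM, hMd, hM1, hMZ, hMt⟩ := h
  have : ∀ z, ∃ i, ∀ hz : z ∈ A ∩ B, (⟨z, hz.2⟩ : B) ∈ M i := by
    intro z
    by_cases hz : z ∈ A ∩ B
    · obtain ⟨i, hi⟩ := hMZ ⟨z, hz.2⟩ hz.1
      exact ⟨i, fun _ => hi⟩
    · exact ⟨0, fun h => (hz h).elim⟩
  choose f hf using this
  have hinj : ∀ z ∈ A ∩ B, ∀ w ∈ A ∩ B, z ≠ w → f z ≠ f w := by
    intro z hz w hw hzw hfe
    have := (hM1 (f z)).unique ⟨hz.1, hf z hz⟩ ⟨hw.1, hfe ▸ hf w hw⟩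
    exact hzw (congrArg Subtype.val this)
  refine ⟨fun z => (↑) '' M (f z), fun z hz => ⟨⟨_, hf z hz, rfl⟩, ?_, ?_⟩,
    fun z hz w hw hzw => ⟨?_, ?_⟩⟩
  · rintro _ ⟨v, hv, rfl⟩ hvA
    exact congrArg Subtype.val ((hM1 (f z)).unique ⟨hvA, hv⟩ ⟨hz.1, hf z hz⟩)
  · have := (induce_connected_iff.1 (hM (f z))).2
    rintro _ ⟨a, ha, rfl⟩ _ ⟨b, hb, rfl⟩
    exact (this a ha b hb).lift _ fun u v ⟨e, hu, hv⟩ => ⟨e, ⟨u, hu, rfl⟩, ⟨v, hv, rfl⟩⟩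
  · exact Set.disjoint_image_of_injective Subtype.val_injective (hMd _ _ (hinj z hz w hw hzw))
  · obtain ⟨u, hu, v, hv, e⟩ := hMt _ _ (hinj z hz w hw hzw)
    exact ⟨u, ⟨u, hu, rfl⟩, v, ⟨v, hv, rfl⟩, e⟩

theorem isMinor_sideGraph {V : Type} {G : SimpleGraph V} {A B : Set V}
    (h : HasRootedK4Model (G.induce B) {x : ↥B | (x : V) ∈ A}) : IsMinor (sideGraph G A B) G := by
  obtain ⟨β, hβ, hβd⟩ := h.exists_bags
  let γ : A → Set V := fun a => if (a : V) ∈ B then β a else {(a : V)}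
  have hγ : ∀ a : A, (a : V) ∈ γ a ∧ (∀ v ∈ γ a, v ∈ A → v = a) ∧ PreconnOn G (γ a) := by
    intro a
    by_cases ha : (a : V) ∈ B
    · simpa [γ, ha] using hβ a ⟨a.2, ha⟩
    · simpa [γ, ha] using preconnOn_singleton (a : V)
  refine ⟨γ, fun a => induce_connected_iff.2 ⟨⟨a, (hγ a).1⟩, (hγ a).2.2⟩, fun a b hab => ?_,
    fun a b ⟨hab, e⟩ => ?_⟩
  · have hab' : (a : V) ≠ b := fun h => hab (Subtype.ext h)
    by_cases ha : (a : V) ∈ B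
    · by_cases hb : (b : V) ∈ B
      · simpa [γ, ha, hb] using (hβd a ⟨a.2, ha⟩ b ⟨b.2, hb⟩ hab').1
      · have : γ b = {(b : V)} := if_neg hb
        rw [this, Set.disjoint_singleton_right]
        exact fun h => hab' ((hγ a).2.1 b h b.2).symm
    · have : γ a = {(a : V)} := if_neg ha
      rw [this, Set.disjoint_singleton_left]
      exact fun h => hab' ((hγ b).2.1 a h a.2)
  · by_cases h : (a : V) ∈ B ∧ (b : V) ∈ B
    · simpa [γ, h, Touch] using (hβd a ⟨a.2, h.1⟩ b ⟨b.2, h.2⟩ fun h => hab (Subtype.ext h)).2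
    · exact ⟨a, (hγ a).1, b, (hγ b).1, e.resolve_right h⟩

/-- `(A, B)` is a non-trivial `4`-separation of the `4`-connected graph `G`, and `Z = A ∩ B`. -/
structure FourSeparation (G : SimpleGraph V) (A B : Set V) (Z : Finset V) : Prop where
  conn : IsKConnected 4 G
  sep : IsSeparation G A B
  card : Z.card = 4
  mem : ∀ v, v ∈ Z ↔ v ∈ A ∧ v ∈ B
  left_ne : A ≠ Set.univ
  right_ne : B ≠ Set.univ

namespace FourSeparation

variable {G : SimpleGraph V} {A B : Set V} {Z : Finset V}

theorem symm (h : FourSeparation G A B Z) : FourSeparation G B A Z :=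
  ⟨h.conn, ⟨Set.union_comm A B ▸ h.sep.1, fun _ _ e h' => h.sep.2 e.symm ⟨h'.2, h'.1⟩⟩, h.card,
    fun v => (h.mem v).trans and_comm, h.right_ne, h.left_ne⟩

theorem mem_or (h : FourSeparation G A B Z) (v : V) : v ∈ A ∨ v ∈ B := by
  have := Set.mem_univ v
  rwa [← h.sep.1] at this

theorem mem_of_adj (h : FourSeparation G A B Z) {u v : V} (e : G.Adj u v) (hu : u ∉ B) : v ∈ A := by
  by_contra hv
  exact h.sep.2 e ⟨⟨(h.mem_or u).resolve_right hu, hu⟩, (h.mem_or v).resolve_left hv, hv⟩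

theorem disjoint (h : FourSeparation G A B Z) : Disjoint Z (off B) :=
  Finset.disjoint_left.2 fun v hv hv' => mem_off.1 hv' ((h.mem v).1 hv).2

theorem disjoint_off (h : FourSeparation G A B Z) : Disjoint (off A) (off B) :=
  Finset.disjoint_left.2 fun v hv hv' => (h.mem_or v).elim (mem_off.1 hv) (mem_off.1 hv')

theorem nbr_subset (h : FourSeparation G A B Z) {C : Finset V} (hC : C ⊆ off B) : nbr G C ⊆ off B ∪ Z := by
  intro v hv
  obtain ⟨hvC, c, hc, e⟩ := mem_nbr.1 hv
  have := h.mem_of_adj e (mem_off.1 (hC hc))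
  rw [Finset.mem_union, mem_off, h.mem]
  tauto

theorem four_le_card_nbr (h : FourSeparation G A B Z) {C : Finset V} (hC : C ⊆ off B) (hne : C.Nonempty) :
    4 ≤ (nbr G C).card := by
  by_contra! hlt
  obtain ⟨c, hc⟩ := hne
  obtain ⟨w, hw⟩ := (Set.ne_univ_iff_exists_notMem A).1 h.left_ne
  have hconn := (induce_connected_iff.1 (h.conn.2 (nbr G C) (by simpa using hlt))).2
  have hcn : c ∉ nbr G C := fun h => (mem_nbr.1 h).1 hc
  have hwC : w ∉ C := fun hwC => Finset.disjoint_left.1 h.disjoint_off (mem_off.2 hw) (hC hwC)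
  have hwn : w ∉ nbr G C := fun hwn => by
    have := Finset.mem_union.1 (h.nbr_subset hC hwn)
    rw [h.mem, mem_off] at this
    have := h.mem_or w
    tauto
  refine hwC (hconn.subset_of_closed (X := C) (by simpa using hcn) hc ?_ (by simpa using hwn))
  intro u _ v hv e huC
  by_contra hvC
  exact hv (Finset.mem_coe.2 (mem_nbr.2 ⟨hvC, u, huC, e⟩))

theorem biclique (h : FourSeparation G A B Z) (hh : Heavy G (off B)) : RootedBiclique G Z (off B) := by
  refine Massed.biclique ⟨h.disjoint, fun v hv => ?_, hh, fun C hC hlt hCh => ?_⟩ h.card.le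
  · exact (Finset.mem_union.1 (h.nbr_subset subset_rfl hv)).resolve_left (mem_nbr.1 hv).1
  · have := h.four_le_card_nbr hC hCh.nonempty
    have := h.card
    omega

theorem nonempty_off (h : FourSeparation G A B Z) : (off B).Nonempty := by
  obtain ⟨w, hw⟩ := (Set.ne_univ_iff_exists_notMem B).1 h.right_ne
  exact ⟨w, mem_off.2 hw⟩

theorem apexClique_of_clique (h : FourSeparation G A B Z) (hZ : ∀ a ∈ Z, ∀ b ∈ Z, a ≠ b → G.Adj a b) :
    RootedApexClique G Z (off B) := by
  obtain ⟨w, hw⟩ := h.nonempty_off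
  set C := (off B).filter fun v => Relation.ReflTransGen
    (fun u v => G.Adj u v ∧ u ∈ off B ∧ v ∈ off B) w v with hCdef
  have hmem : ∀ v, v ∈ C ↔ v ∈ off B ∧ Relation.ReflTransGen
    (fun u v => G.Adj u v ∧ u ∈ off B ∧ v ∈ off B) w v := by simp [hCdef]
  have hwC : w ∈ C := (hmem w).2 ⟨hw, .refl⟩
  have hCB : C ⊆ off B := Finset.filter_subset _ _
  have hn : nbr G C = Z := by
    refine Finset.eq_of_subset_of_card_le (fun v hv => ?_) ?_
    · refine (Finset.mem_union.1 (h.nbr_subset hCB hv)).resolve_left fun hvB => ?_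
      obtain ⟨hvC, c, hc, e⟩ := mem_nbr.1 hv
      exact hvC ((hmem v).2 ⟨hvB, ((hmem c).1 hc).2.tail ⟨e, hCB hc, hvB⟩⟩)
    · exact h.card.trans_le (h.four_le_card_nbr hCB ⟨w, hwC⟩)
  refine ⟨fun z => {z}, C, ⟨fun z _ => ⟨rfl, by simp, preconnOn_singleton z⟩, fun z _ w _ h => by
    simpa using h⟩, fun z hz w hw hzw => ⟨z, rfl, w, rfl, hZ z hz w hw hzw⟩,
    Finset.coe_subset.2 hCB, ⟨w, hwC⟩, preconnOn_of_center w fun a ha => ?_, fun z hz => ?_⟩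
  · have := ((hmem a).1 ha).2
    clear ha
    induction this with
    | refl => exact .refl
    | tail hab e ih =>
      exact ih.tail ⟨e.1, (hmem _).2 ⟨e.2.1, hab⟩, (hmem _).2 ⟨e.2.2, hab.tail e⟩⟩
  · rw [← hn] at hz
    obtain ⟨hzC, c, hc, e⟩ := mem_nbr.1 hz
    exact ⟨by simpa using hzC, z, rfl, c, hc, e.symm⟩

theorem sideGraph_connected (h : FourSeparation G A B Z) : IsKConnected 4 (sideGraph G A B) := by
  refine ⟨?_, fun S hS => ?_⟩
  · obtain ⟨w, hw⟩ := h.nonempty_off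
    have hwZ : w ∉ Z := fun hwZ => Finset.disjoint_left.1 h.disjoint hwZ hw
    have hsub : insert w Z ⊆ Finset.univ.filter (· ∈ A) := by
      intro v hv
      rcases Finset.mem_insert.1 hv with rfl | hv
      · simpa using (h.mem_or v).resolve_right (mem_off.1 hw)
      · simpa using ((h.mem v).1 hv).1
    have := Finset.card_le_card hsub
    rw [Finset.card_insert_of_notMem hwZ, h.card] at this
    rw [Fintype.card_subtype]
    exact this
  · obtain ⟨z, hzZ, hzS⟩ : ∃ z ∈ Z, z ∉ (↑) '' S := by
      by_contra! hsub
      have := Set.ncard_le_ncard (s := (Z : Set V)) hsub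
      rw [Set.ncard_coe_finset, Set.ncard_image_of_injective _ Subtype.val_injective, h.card] at this
      omega
    obtain ⟨hzA, hzB⟩ := (h.mem z).1 hzZ
    have hz : ⟨z, hzA⟩ ∈ Sᶜ := fun hzS' => hzS ⟨_, hzS', rfl⟩
    have hconn := (induce_connected_iff.1 (h.conn.2 ((↑) '' S)
      (by rwa [Set.ncard_image_of_injective _ Subtype.val_injective]))).2
    refine induce_connected_iff.2 ⟨⟨_, hz⟩, fun a ha b hb => ?_⟩
    let π : V → A := fun v => if hv : v ∈ A then ⟨v, hv⟩ else ⟨z, hzA⟩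
    have hπ : ∀ a : A, π a = a := fun a => by simp [π]
    have hπ' : ∀ v ∉ A, π v = ⟨z, hzA⟩ := fun v hv => by simp [π, hv]
    have hπS : ∀ v ∈ ((↑) '' S : Set V)ᶜ, π v ∈ Sᶜ := by
      intro v hv
      by_cases hvA : v ∈ A
      · exact hπ ⟨v, hvA⟩ ▸ fun hvS => hv ⟨_, hvS, rfl⟩
      · exact hπ' v hvA ▸ hz
    have hadj : ∀ u v, G.Adj u v → π u ≠ π v → (sideGraph G A B).Adj (π u) (π v) := by
      intro u v e hne
      refine ⟨hne, ?_⟩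
      by_cases hu : u ∈ A
      · have hu' : π u = ⟨u, hu⟩ := hπ ⟨u, hu⟩
        by_cases hv : v ∈ A
        · have hv' : π v = ⟨v, hv⟩ := hπ ⟨v, hv⟩
          rw [hu', hv']
          exact .inl e
        · rw [hu', hπ' v hv]
          exact .inr ⟨by_contra fun huB => hv (h.mem_of_adj e huB), hzB⟩
      · by_cases hv : v ∈ A
        · have hv' : π v = ⟨v, hv⟩ := hπ ⟨v, hv⟩
          rw [hπ' u hu, hv']
          exact .inr ⟨hzB, by_contra fun hvB => hu (h.mem_of_adj e.symm hvB)⟩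
        · exact (hne ((hπ' u hu).trans (hπ' v hv).symm)).elim
    have hne : ∀ a ∈ Sᶜ, (a : V) ∈ ((↑) '' S : Set V)ᶜ := by
      rintro a ha ⟨b, hb, hab⟩
      exact ha (Subtype.ext hab ▸ hb)
    have := Relation.ReflTransGen.lift' (p := fun u v => (sideGraph G A B).Adj u v ∧ u ∈ Sᶜ ∧ v ∈ Sᶜ)
      π (fun u v huv => ?_) _ _ (hconn a (hne a ha) b (hne b hb))
    · rwa [Function.onFun, hπ, hπ] at this
    · obtain ⟨e, hu, hv⟩ := huv
      by_cases huv : π u = π v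
      · rw [Function.onFun, huv]
      · exact .single ⟨hadj u v e huv, hπS u hu, hπS v hv⟩

theorem card_left (h : FourSeparation G A B Z) : Fintype.card A = (off B).card + 4 := by
  rw [← h.card, ← Finset.card_union_of_disjoint h.disjoint.symm, Fintype.card_subtype]
  congr 1
  ext v
  have := h.mem_or v
  simp only [Finset.mem_filter, Finset.mem_univ, true_and, Finset.mem_union, mem_off, h.mem]
  tauto

theorem card_univ (h : FourSeparation G A B Z) : Fintype.card V = (off A).card + (off B).card + 4 := by
  rw [add_assoc, ← h.card_left, ← Finset.card_univ, ← Finset.card_filter_add_card_filter_not (· ∉ A),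
    off, Fintype.card_subtype]
  simp

theorem twice_card_sideGraph (h : FourSeparation G A B Z) :
    2 * (sideGraph G A B).edgeSet.ncard = (pairs G (off B)).card + 12 := by
  have h12 : Z.offDiag.card = 12 := by rw [Finset.offDiag_card, h.card]
  have hd : Disjoint (pairs G (off B)) Z.offDiag := by
    refine Finset.disjoint_left.2 fun p hp hq => ?_
    have hp := (mem_pairs.1 hp).2
    obtain ⟨h1, h2, -⟩ := Finset.mem_offDiag.1 hq
    exact hp.elim (Finset.disjoint_left.1 h.disjoint h1) (Finset.disjoint_left.1 h.disjoint h2)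
  rw [← h12, ← Finset.card_union_of_disjoint hd, ← card_pairs_univ, ← Finset.card_map
    ((Function.Embedding.subtype (· ∈ A)).prodMap (Function.Embedding.subtype (· ∈ A)))]
  congr 1
  ext ⟨a, b⟩
  simp only [Finset.mem_map, mem_pairs, Finset.mem_univ, or_self, and_true, Finset.mem_union,
    Finset.mem_offDiag, mem_off, h.mem]
  constructor
  · rintro ⟨⟨⟨a', ha⟩, ⟨b', hb⟩⟩, ⟨hne, e⟩, heq⟩
    obtain ⟨rfl, rfl⟩ := Prod.mk.inj heq
    have hne' : a' ≠ b' := fun h => hne (Subtype.ext h)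
    simp only [Function.Embedding.subtype_apply] at *
    tauto
  · rintro (⟨e, hab⟩ | ⟨⟨haA, haB⟩, ⟨hbA, hbB⟩, hne⟩)
    · have hb : b ∈ A := (em (a ∈ B)).elim (fun ha => (h.mem_or b).resolve_right
        (hab.resolve_left (not_not.2 ha))) (h.mem_of_adj e)
      have ha : a ∈ A := (em (b ∈ B)).elim (fun hb => (h.mem_or a).resolve_right
        (hab.resolve_right (not_not.2 hb))) (h.mem_of_adj e.symm)
      exact ⟨(⟨a, ha⟩, ⟨b, hb⟩), ⟨fun h => e.ne (congrArg Subtype.val h), .inl e⟩, rfl⟩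
    · exact ⟨(⟨a, haA⟩, ⟨b, hbA⟩), ⟨fun h => hne (congrArg Subtype.val h), .inr ⟨haB, hbB⟩⟩, rfl⟩

theorem twice_card_le (h : FourSeparation G A B Z) : 2 * G.edgeSet.ncard ≤ (pairs G (off A)).card + (pairs G (off B)).card +
    (Z.offDiag.filter fun p => G.Adj p.1 p.2).card := by
  rw [← card_pairs_univ]
  refine (Finset.card_le_card fun p hp => ?_).trans ((Finset.card_union_le _ _).trans
    (Nat.add_le_add_right (Finset.card_union_le _ _) _))
  have e := (mem_pairs.1 hp).1
  have := e.ne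
  simp only [Finset.mem_union, mem_pairs, mem_off, Finset.mem_filter, Finset.mem_offDiag, h.mem]
  tauto

end FourSeparation

theorem card_edgeSet_K2222 : K2222.edgeSet.ncard = 24 := by
  have h := card_pairs_univ K2222
  have : (pairs K2222 Finset.univ).card = 48 := by
    have : pairs K2222 Finset.univ =
        Finset.univ.filter fun p : (Fin 4 × Fin 2) × (Fin 4 × Fin 2) => p.1.1 ≠ p.2.1 := by
      ext p
      simp [mem_pairs, K2222]
    rw [this]
    convert (by decide : (Finset.univ.filter fun p : (Fin 4 × Fin 2) × (Fin 4 × Fin 2) =>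
      p.1.1 ≠ p.2.1).card = 48)
  omega

namespace FourSeparation

variable {G : SimpleGraph V} {A B : Set V} {Z : Finset V}

theorem card_pairs_le_or (h : FourSeparation G A B Z) (hG : MinorMinimalEnemy G)
    (hK : HasRootedK4Model (G.induce B) {x : ↥B | (x : V) ∈ A}) :
    (pairs G (off B)).card ≤ 8 * (off B).card + 2 ∨
      (Nonempty (sideGraph G A B ≃g K2222) ∧ (pairs G (off B)).card = 8 * (off B).card + 4) := by
  have hmin := isMinor_sideGraph hK
  have hlt : Fintype.card A < Fintype.card V := by
    obtain ⟨w, hw⟩ := h.symm.nonempty_off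
    exact Fintype.card_subtype_lt (mem_off.1 hw)
  have hA := h.card_left
  have hE := h.twice_card_sideGraph
  by_cases hiso : Nonempty (sideGraph G A B ≃g K2222)
  · refine .inr ⟨hiso, ?_⟩
    obtain ⟨φ⟩ := hiso
    have h1 : Fintype.card A = 8 := by simpa using Fintype.card_congr φ.toEquiv
    have h2 : (sideGraph G A B).edgeSet.ncard = 24 := by
      rw [← card_edgeSet_K2222]
      exact Nat.card_congr φ.mapEdgeSet
    omega
  · left
    have hne : ¬ Enemy (sideGraph G A B) := fun he => by
      obtain ⟨φ⟩ := hG.2 A _ hmin he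
      exact hlt.ne (Fintype.card_congr φ.toEquiv)
    have hlow : ¬ 4 * (Fintype.card A : ℤ) - 8 ≤ ((sideGraph G A B).edgeSet.ncard : ℤ) := fun hle =>
      hne ⟨h.sideGraph_connected, hle, fun hm => hG.1.2.2.1 (hm.trans hmin),
        not_nonempty_iff.1 hiso⟩
    omega

theorem apexClique_of_iso (h : FourSeparation G A B Z) (φ : sideGraph G A B ≃g K2222) {b d : V} (hb : b ∈ Z) (hd : d ∈ Z)
    (e : G.Adj b d) : RootedApexClique G Z (off B) := by
  obtain ⟨a, c, hac, hZac⟩ : ∃ a c, a ≠ c ∧ (Z.erase b).erase d = {a, c} := by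
    rw [← Finset.card_eq_two, Finset.card_erase_of_mem (Finset.mem_erase.2 ⟨e.ne', hd⟩),
      Finset.card_erase_of_mem hb, h.card]
  have hbd := e.ne
  have hmem : ∀ z, z ∈ Z ↔ z = a ∨ z = c ∨ z = b ∨ z = d := by
    intro z
    have : z ∈ (Z.erase b).erase d ↔ z = a ∨ z = c := by simp [hZac]
    rw [Finset.mem_erase, Finset.mem_erase] at this
    grind
  have ha' : a ∈ (Z.erase b).erase d := by simp [hZac]
  have hc' : c ∈ (Z.erase b).erase d := by simp [hZac]
  simp only [Finset.mem_erase] at ha' hc'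
  obtain ⟨had, hab, ha⟩ := ha'
  obtain ⟨hcd, hcb, hc⟩ := hc'
  have hK : ∀ p q : Fin 4 × Fin 2, K2222.Adj p q ↔ p.1 ≠ q.1 := fun p q => by simp [K2222]
  let w : V → V := fun z => if hz : z ∈ A then φ.symm ((φ ⟨z, hz⟩).1, (φ ⟨z, hz⟩).2 + 1) else z
  have hw : ∀ z (hz : z ∈ A), ∃ v : A, (v : V) = w z ∧ v ≠ ⟨z, hz⟩ ∧
      (φ v).1 = (φ ⟨z, hz⟩).1 := by
    intro z hz
    refine ⟨φ.symm ((φ ⟨z, hz⟩).1, (φ ⟨z, hz⟩).2 + 1), by simp [w, hz], fun h => ?_, by simp⟩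
    have := congrArg (fun v => (φ v).2) h
    simp at this
  have hZ : ∀ y z (hy : y ∈ Z) (hz : z ∈ Z), y ≠ z →
      (φ ⟨y, ((h.mem y).1 hy).1⟩).1 ≠ (φ ⟨z, ((h.mem z).1 hz).1⟩).1 := by
    intro y z hy hz hyz
    rw [← hK, φ.map_adj_iff]
    exact ⟨fun h => hyz (congrArg Subtype.val h), .inr ⟨((h.mem y).1 hy).2, ((h.mem z).1 hz).2⟩⟩
  have hwB : ∀ z ∈ Z, w z ∉ B := by
    intro z hz hzB
    obtain ⟨v, hv, hne, hφ⟩ := hw z ((h.mem z).1 hz).1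
    refine ((hK _ _).1 (φ.map_adj_iff.2 ⟨hne, .inr ⟨hv ▸ hzB, ((h.mem z).1 hz).2⟩⟩)) hφ
  have hadj : ∀ y ∈ Z, ∀ z ∈ Z, y ≠ z → G.Adj y (w z) := by
    intro y hy z hz hyz
    obtain ⟨v, hv, hne, hφ⟩ := hw z ((h.mem z).1 hz).1
    have := φ.map_adj_iff.1 ((hK _ _).2 (hφ ▸ hZ y z hy hz hyz))
    exact hv ▸ this.2.resolve_right fun h => hwB z hz (hv ▸ h.2)
  have hadj' : ∀ y ∈ Z, ∀ z ∈ Z, y ≠ z → G.Adj (w y) (w z) := by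
    intro y hy z hz hyz
    obtain ⟨u, hu, -, hφ'⟩ := hw y ((h.mem y).1 hy).1
    obtain ⟨v, hv, -, hφ⟩ := hw z ((h.mem z).1 hz).1
    have := φ.map_adj_iff.1 ((hK _ _).2 (hφ ▸ hφ' ▸ hZ y z hy hz hyz))
    exact hu ▸ hv ▸ this.2.resolve_right fun h => hwB z hz (hv ▸ h.2)
  have hwZ : ∀ y ∈ Z, ∀ z ∈ Z, w y ≠ z := fun y hy z hz heq =>
    hwB y hy (heq ▸ ((h.mem z).1 hz).2)
  set L : V → Set V := fun z => {v | v = z ∨ (z = a ∧ v = w c) ∨ (z = c ∧ v = w a)} with hLdef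
  have hL : ∀ z v, v ∈ L z ↔ v = z ∨ (z = a ∧ v = w c) ∨ (z = c ∧ v = w a) := fun z v => Iff.rfl
  have hinj : ∀ y ∈ Z, ∀ z ∈ Z, y ≠ z → w y ≠ w z := fun y hy z hz hyz => (hadj' y hy z hz hyz).ne
  refine ⟨L, {w b, w d}, ⟨fun z hz => ⟨.inl rfl, ?_, ?_⟩, ?_⟩, ?_, ?_, ⟨w b, .inl rfl⟩, ?_, ?_⟩
  · rintro v (rfl | ⟨-, rfl⟩ | ⟨-, rfl⟩)
    exacts [.inl rfl, .inr (mem_off.2 (hwB c hc)), .inr (mem_off.2 (hwB a ha))]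
  · refine preconnOn_of_center z ?_
    rintro v (rfl | ⟨rfl, rfl⟩ | ⟨rfl, rfl⟩)
    · exact .refl
    · exact .single ⟨hadj _ ha _ hc hac, .inl rfl, .inr (.inl ⟨rfl, rfl⟩)⟩
    · exact .single ⟨hadj _ hc _ ha hac.symm, .inl rfl, .inr (.inr ⟨rfl, rfl⟩)⟩
  · intro y hy z hz hyz
    have := hinj a ha c hc hac
    have h1 := hwZ c hc
    have h2 := hwZ a ha
    refine Set.disjoint_left.2 fun v hv hv' => ?_
    rw [hL] at hv hv'
    clear_value L w
    clear hwZ hinj hadj hadj' hwB hZ hw hK hL hLdef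
    grind
  · have hne : ∀ y ∈ Z, ∀ z ∈ Z, y ≠ z → y = a ∨ y = c → Touch G (L y) (L z) := by
      rintro y hy z hz hyz (rfl | rfl)
      · by_cases hzc : z = c
        · exact ⟨w c, .inr (.inl ⟨rfl, rfl⟩), w y, .inr (.inr ⟨hzc, rfl⟩), hadj' _ hc _ ha hac.symm⟩
        · exact ⟨w c, .inr (.inl ⟨rfl, rfl⟩), z, .inl rfl, (hadj z hz c hc hzc).symm⟩
      · by_cases hza : z = a
        · exact ⟨w a, .inr (.inr ⟨rfl, rfl⟩), w y, .inr (.inl ⟨hza, rfl⟩), hadj' _ ha _ hc hac⟩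
        · exact ⟨w a, .inr (.inr ⟨rfl, rfl⟩), z, .inl rfl, (hadj z hz a ha hza).symm⟩
    intro y hy z hz hyz
    by_cases h1 : y = a ∨ y = c
    · exact hne y hy z hz hyz h1
    by_cases h2 : z = a ∨ z = c
    · exact (hne z hz y hy hyz.symm h2).symm
    have hy' := (or_assoc.2 ((hmem y).1 hy)).resolve_left h1
    have hz' := (or_assoc.2 ((hmem z).1 hz)).resolve_left h2
    refine ⟨y, .inl rfl, z, .inl rfl, ?_⟩
    rcases hy' with rfl | rfl <;> rcases hz' with rfl | rfl
    exacts [(hyz rfl).elim, e, e.symm, (hyz rfl).elim]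
  · rintro v (rfl | rfl)
    exacts [mem_off.2 (hwB b hb), mem_off.2 (hwB d hd)]
  · exact (preconnOn_singleton (w b)).union (preconnOn_singleton (w d))
      ⟨w b, rfl, w d, rfl, hadj' b hb d hd hbd⟩
  · refine fun z hz => ⟨Set.disjoint_left.2 ?_, ?_⟩
    · rintro v (rfl | ⟨-, rfl⟩ | ⟨-, rfl⟩) (h' | h')
      exacts [hwZ b hb _ hz h'.symm, hwZ d hd _ hz h'.symm, hinj c hc b hb hcb h',
        hinj c hc d hd hcd h', hinj a ha b hb hab h', hinj a ha d hd had h']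
    · by_cases hzb : z = b
      · exact ⟨z, .inl rfl, w d, .inr rfl, hadj z hz d hd (hzb ▸ hbd)⟩
      · exact ⟨z, .inl rfl, w b, .inl rfl, hadj z hz b hb hzb⟩

theorem false_of_heavy (h : FourSeparation G A B Z) (hG : Enemy G) (hA : RootedApexClique G Z (off B))
    (hB : Heavy G (off A)) : False :=
  hG.2.2.1 (isMinor_K7vee h.card h.disjoint_off.symm h.disjoint h.symm.disjoint hA
    (h.symm.biclique hB))

end FourSeparation

theorem MinorMinimalEnemy.no_fourSeparation {G : SimpleGraph V} (hG : MinorMinimalEnemy G)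
    {A B : Set V} {Z : Finset V} (h : FourSeparation G A B Z)
    (hA : HasRootedK4Model (G.induce A) {x : ↥A | (x : V) ∈ B})
    (hB : HasRootedK4Model (G.induce B) {x : ↥B | (x : V) ∈ A}) : False := by
  have hE := h.twice_card_le
  have hV := h.card_univ
  have hlow := hG.1.2.1
  have h12 : Z.offDiag.card = 12 := by rw [Finset.offDiag_card, h.card]
  set T := Z.offDiag.filter fun p => G.Adj p.1 p.2 with hT
  by_cases hcl : ∀ a ∈ Z, ∀ b ∈ Z, a ≠ b → G.Adj a b
  · have hT12 : T.card ≤ 12 := h12 ▸ Finset.card_filter_le _ _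
    by_cases hh : Heavy G (off A)
    · exact h.false_of_heavy hG.1 (h.apexClique_of_clique hcl) hh
    · refine h.symm.false_of_heavy hG.1 (h.symm.apexClique_of_clique hcl) ?_
      simp only [Heavy] at *
      omega
  · have hT11 : T.card < 12 := by
      rw [← h12]
      refine Finset.card_lt_card (Finset.filter_ssubset.2 ?_)
      push Not at hcl
      obtain ⟨a, ha, b, hb, hab, e⟩ := hcl
      exact ⟨(a, b), Finset.mem_offDiag.2 ⟨ha, hb, hab⟩, e⟩
    have h1 := h.card_pairs_le_or hG hB
    have h2 := h.symm.card_pairs_le_or hG hA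
    obtain ⟨⟨b, d⟩, hp⟩ : T.Nonempty := Finset.card_pos.1 (by omega)
    simp only [hT, Finset.mem_filter, Finset.mem_offDiag] at hp
    obtain ⟨⟨hb, hd, -⟩, e⟩ := hp
    rcases h1 with h1 | ⟨⟨φ⟩, h1⟩
    · rcases h2 with h2 | ⟨⟨φ⟩, h2⟩
      · omega
      · refine h.symm.false_of_heavy hG.1 (h.symm.apexClique_of_iso φ hb hd e) ?_
        simp only [Heavy]
        omega
    · refine h.false_of_heavy hG.1 (h.apexClique_of_iso φ hb hd e) ?_
      simp only [Heavy]
      omega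

end FourSeparations

/-- a minor-minimal enemy has no non-trivial 4-separation `(A,B)` such that
`G[A]` and `G[B]` both have an `(A ∩ B)`-rooted `K₄`-model. -/
theorem statement_7 (V : Type) [Fintype V] (G : SimpleGraph V)
    (h : MinorMinimalEnemy G) :
    ¬ ∃ A B : Set V, IsSeparation G A B ∧ (A ∩ B).ncard = 4 ∧
        A ≠ Set.univ ∧ B ≠ Set.univ ∧
        HasRootedK4Model (G.induce A) {x : ↥A | (x : V) ∈ B} ∧
        HasRootedK4Model (G.induce B) {x : ↥B | (x : V) ∈ A} := by
  classical
  rintro ⟨A, B, hsep, hcard, hA, hB, hKA, hKB⟩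
  refine h.no_fourSeparation (Z := (A ∩ B).toFinset) ⟨h.1.1, hsep, ?_, by simp, hA, hB⟩ hKA hKB
  rw [← hcard, Set.ncard_eq_toFinset_card']
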